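/- arXiv:2504.16697 — 5 statements merged into one kernel-verified Lean document; each statement's English description precedes it below -/
import Mathlib

section
/- Let P ∈ ℚ[x,y] be a nonzero polynomial and let f ∈ ℚ[[z]] be a formal power series such that P(z, f(z)) = 0 in ℚ[[z]]. Then there exist an integer r with 0 ≤ r ≤ deg_y(P) and polynomials a_0, …, a_r ∈ ℚ[z], not all zero, each of degree at most 4·deg_x(P)·deg_y(P)^2, such that a_r(z) f^{(r)}(z) + ⋯ + a_1(z) f'(z) + a_0(z) f(z) = 0 in ℚ[[z]]. -/
open MvPolynomial in
def Bd (p : MvPolynomial (Fin 2) ℚ) (a b : ℤ) : Prop :=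
  ∀ m, coeff m p ≠ 0 → (m 0 : ℤ) ≤ a ∧ (m 1 : ℤ) ≤ b

section
open MvPolynomial

lemma Bd.mono {p : MvPolynomial (Fin 2) ℚ} {a b a' b' : ℤ} (h : Bd p a b) (ha : a ≤ a')
    (hb : b ≤ b') : Bd p a' b' := fun m hm => ⟨(h m hm).1.trans ha, (h m hm).2.trans hb⟩

lemma Bd.zero (a b : ℤ) : Bd 0 a b := fun m hm => by simp at hm

lemma Bd.add {p q : MvPolynomial (Fin 2) ℚ} {a b : ℤ} (hp : Bd p a b) (hq : Bd q a b) :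
    Bd (p + q) a b := fun m hm => by
  by_cases h : coeff m p = 0
  · exact hq m (by simpa [h] using hm)
  · exact hp m h

lemma Bd.neg {p : MvPolynomial (Fin 2) ℚ} {a b : ℤ} (hp : Bd p a b) : Bd (-p) a b :=
  fun m hm => hp m (by simpa using hm)

lemma Bd.sub {p q : MvPolynomial (Fin 2) ℚ} {a b : ℤ} (hp : Bd p a b) (hq : Bd q a b) :
    Bd (p - q) a b := by rw [sub_eq_add_neg]; exact hp.add hq.neg

lemma Bd.smul {p : MvPolynomial (Fin 2) ℚ} {a b : ℤ} (c : ℚ) (hp : Bd p a b) : Bd (c • p) a b :=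
  fun m hm => hp m (by
    intro h
    simp [h] at hm)

lemma Bd.sum {ι : Type*} (s : Finset ι) (p : ι → MvPolynomial (Fin 2) ℚ) {a b : ℤ}
    (hp : ∀ i ∈ s, Bd (p i) a b) : Bd (∑ i ∈ s, p i) a b :=
  Finset.sum_induction p (fun q => Bd q a b) (fun _ _ => Bd.add) (Bd.zero a b) hp

lemma Bd.mul {p q : MvPolynomial (Fin 2) ℚ} {a b a' b' : ℤ} (hp : Bd p a b) (hq : Bd q a' b') :
    Bd (p * q) (a + a') (b + b') := fun m hm => by
  rw [coeff_mul] at hm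
  obtain ⟨x, hx, hne⟩ := Finset.exists_ne_zero_of_sum_ne_zero hm
  have h1 := hp _ (left_ne_zero_of_mul hne)
  have h2 := hq _ (right_ne_zero_of_mul hne)
  rw [Finset.HasAntidiagonal.mem_antidiagonal] at hx
  subst hx
  simp only [Finsupp.add_apply]
  push_cast
  omega

lemma Bd.C (c : ℚ) : Bd (C c) 0 0 := fun m hm => by
  rw [coeff_C] at hm
  split_ifs at hm with h
  · subst h; simp
  · exact absurd rfl hm

lemma Bd.X0 : Bd (X 0) 1 0 := fun m hm => by
  rw [coeff_X] at hm
  split_ifs at hm with h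
  · subst h; simp
  · exact absurd rfl hm

lemma Bd.X1 : Bd (X 1) 0 1 := fun m hm => by
  rw [coeff_X] at hm
  split_ifs at hm with h
  · subst h; simp
  · exact absurd rfl hm

lemma Bd.pow {p : MvPolynomial (Fin 2) ℚ} {a b : ℤ} (hp : Bd p a b) (n : ℕ) :
    Bd (p ^ n) (n * a) (n * b) := by
  induction n with
  | zero => simpa using Bd.C 1
  | succ n ih =>
    rw [pow_succ]
    refine (ih.mul hp).mono (le_of_eq ?_) (le_of_eq ?_) <;> push_cast <;> ring

lemma Bd.dx {p : MvPolynomial (Fin 2) ℚ} {a b : ℤ} (hp : Bd p a b) : Bd (pderiv 0 p) a b :=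
  fun m hm => by
  rw [coeff_pderiv] at hm
  have := hp _ (left_ne_zero_of_mul hm)
  simp at this
  omega

lemma Bd.dy {p : MvPolynomial (Fin 2) ℚ} {a b : ℤ} (hp : Bd p a b) : Bd (pderiv 1 p) a (b - 1) :=
  fun m hm => by
  rw [coeff_pderiv] at hm
  have := hp _ (left_ne_zero_of_mul hm)
  simp at this
  omega

lemma Bd_of_degreeOf (p : MvPolynomial (Fin 2) ℚ) : Bd p (p.degreeOf 0) (p.degreeOf 1) :=
  fun m hm => by
  have h : m ∈ p.support := mem_support_iff.2 hm
  exact ⟨by exact_mod_cast degreeOf_le_iff.1 le_rfl m h,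
    by exact_mod_cast degreeOf_le_iff.1 le_rfl m h⟩

lemma chain (f : PowerSeries ℚ) (p : MvPolynomial (Fin 2) ℚ) :
    PowerSeries.derivative (R := ℚ) (aeval ![PowerSeries.X, f] p) =
      aeval ![PowerSeries.X, f] (pderiv 0 p) +
      aeval ![PowerSeries.X, f] (pderiv 1 p) * PowerSeries.derivative (R := ℚ) f := by
  induction p using MvPolynomial.induction_on with
  | C a => simp
  | add p q hp hq => simp only [map_add, hp, hq]; ring
  | mul_X p n hp =>
    fin_cases n
    · simp [Derivation.leibniz, hp, pderiv_X]
      ring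
    · simp [Derivation.leibniz, hp, pderiv_X]
      ring

lemma base_case (f : PowerSeries ℚ) (p : MvPolynomial (Fin 2) ℚ) (h : ∀ m, coeff m p ≠ 0 → m 1 = 0)
    (h0 : aeval ![PowerSeries.X, f] p = 0) : p = 0 := by
  by_contra hp
  obtain ⟨m, hm⟩ := exists_coeff_ne_zero hp
  rw [aeval_def, eval₂_eq'] at h0
  have := congrArg (PowerSeries.coeff (m 0)) h0
  rw [map_sum, (PowerSeries.coeff (m 0)).map_zero, Finset.sum_eq_single m] at this
  · apply hm
    simpa [Fin.prod_univ_two, h m hm, PowerSeries.coeff_X_pow] using this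
  · intro b hb hne
    have hb' := h b (mem_support_iff.1 hb)
    have : m 0 ≠ b 0 := by
      intro h2
      apply hne
      ext i
      fin_cases i
      · exact h2.symm
      · simp [hb', h m hm]
    simp [Fin.prod_univ_two, hb', PowerSeries.coeff_X_pow, this]
  · intro hh
    exact absurd (mem_support_iff.2 hm) hh

lemma exists_good (f : PowerSeries ℚ) (h n : ℕ) : ∀ p : MvPolynomial (Fin 2) ℚ, p ≠ 0 →
    Bd p h n → aeval ![PowerSeries.X, f] p = 0 →
    ∃ q : MvPolynomial (Fin 2) ℚ, q ≠ 0 ∧ Bd q h n ∧ aeval ![PowerSeries.X, f] q = 0 ∧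
      aeval ![PowerSeries.X, f] (pderiv 1 q) ≠ 0 := by
  induction n with
  | zero =>
    intro p hp hb he
    refine absurd (base_case f p (fun m hm => ?_) he) hp
    have := (hb m hm).2
    simpa using this
  | succ n ih =>
    intro p hp hb he
    by_cases h1 : aeval ![PowerSeries.X, f] (pderiv 1 p) = 0
    · by_cases h2 : pderiv 1 p = 0
      · refine absurd (base_case f p (fun m hm => ?_) he) hp
        by_contra h3
        have h4 := coeff_pderiv (i := 1) p (m - Finsupp.single 1 1)
        rw [h2, tsub_add_cancel_of_le (by simpa using Nat.one_le_iff_ne_zero.2 h3)] at h4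
        have h5 := h4.symm
        rw [coeff_zero, mul_eq_zero] at h5
        rcases h5 with h5 | h5
        · exact hm h5
        · exact absurd h5 (by positivity)
      · obtain ⟨q, hq, hqb, h3⟩ := ih _ h2 (hb.dy.mono le_rfl (by push_cast; omega)) h1
        exact ⟨q, hq, hqb.mono le_rfl (by push_cast; omega), h3⟩
    · exact ⟨p, hp, hb, he, h1⟩

lemma derivs (f : PowerSeries ℚ) (P : MvPolynomial (Fin 2) ℚ) (h d : ℤ) (hb : Bd P h (d + 1))
    (he : aeval ![PowerSeries.X, f] P = 0) (i : ℕ) :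
    ∃ R, Bd R ((2 * i + 1) * h) (d + 1 + i * (2 * d)) ∧
      (aeval ![PowerSeries.X, f] (pderiv 1 P)) ^ (2 * i + 1) *
        (⇑(PowerSeries.derivative (R := ℚ)))^[i + 1] f = aeval ![PowerSeries.X, f] R := by
  have h0 := chain f P
  rw [he, map_zero] at h0
  induction i with
  | zero =>
    refine ⟨- pderiv 0 P, hb.dx.neg.mono (by simp) (by simp), ?_⟩
    simp only [map_neg, Function.iterate_succ, Function.iterate_zero, Function.comp, id]
    linear_combination -h0
  | succ i ih =>
    obtain ⟨R, hR, hR'⟩ := ih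
    refine ⟨pderiv 0 R * pderiv 1 P ^ 2 - pderiv 1 R * pderiv 0 P * pderiv 1 P
      - C (2 * i + 1 : ℚ) * R * (pderiv 0 (pderiv 1 P) * pderiv 1 P
        - pderiv 1 (pderiv 1 P) * pderiv 0 P), ?_, ?_⟩
    · refine Bd.sub (Bd.sub ?_ ?_) ?_
      · exact (hR.dx.mul (hb.dy.pow 2)).mono (by push_cast; linarith) (by push_cast; linarith)
      · exact ((hR.dy.mul hb.dx).mul hb.dy).mono (by push_cast; linarith) (by push_cast; linarith)
      · refine (((Bd.C _).mul hR).mul (a' := 2 * h) (b' := 2 * d) (Bd.sub ?_ ?_)).mono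
          (by push_cast; linarith) (by push_cast; linarith)
        · exact (hb.dy.dx.mul hb.dy).mono (by linarith) (by linarith)
        · exact (hb.dy.dy.mul hb.dx).mono (by linarith) (by linarith)
    · have h1 := congrArg (PowerSeries.derivative (R := ℚ)) hR'
      rw [chain, Derivation.leibniz, Derivation.leibniz_pow, chain] at h1
      rw [Function.iterate_succ_apply' _ (i+1)]
      have hC : aeval ![PowerSeries.X, f] (C (2 * i + 1 : ℚ) : MvPolynomial (Fin 2) ℚ) =
        2 * (i : PowerSeries ℚ) + 1 := by
        simp only [map_add, map_mul, map_one, map_ofNat, map_natCast]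
      simp only [map_sub, map_mul, map_pow, hC]
      generalize (⇑(PowerSeries.derivative (R := ℚ)))^[i + 1] f = F at *
      simp only [smul_eq_mul, nsmul_eq_mul, Nat.add_sub_cancel] at h1
      push_cast at h1
      generalize PowerSeries.derivative (R := ℚ) F = F' at *
      generalize PowerSeries.derivative (R := ℚ) f = f' at *
      rw [← hR']
      generalize aeval ![PowerSeries.X, f] (pderiv 1 P) = g at *
      generalize aeval ![PowerSeries.X, f] (pderiv 0 P) = px at *
      have hpx : px = - (g * f') := by linear_combination -h0
      subst hpx
      rw [show 2 * (i + 1) + 1 = 2 * i + 1 + 2 by ring, pow_add, pow_succ] at *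
      linear_combination g ^ 2 * h1

lemma derivs' (f : PowerSeries ℚ) (P : MvPolynomial (Fin 2) ℚ) (h d : ℕ) (hb : Bd P h (d + 1))
    (he : aeval ![PowerSeries.X, f] P = 0) (i : ℕ) (hi : i ≤ d + 1) :
    ∃ R, Bd R ((2 * d + 1) * h) (d + 1 + d * (2 * d)) ∧
      (aeval ![PowerSeries.X, f] (pderiv 1 P)) ^ (2 * d + 1) *
        (⇑(PowerSeries.derivative (R := ℚ)))^[i] f = aeval ![PowerSeries.X, f] R := by
  cases i with
  | zero =>
    refine ⟨pderiv 1 P ^ (2 * d + 1) * X 1, ?_, by simp⟩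
    exact ((hb.dy.pow (2 * d + 1)).mul Bd.X1).mono (by push_cast; linarith)
      (by push_cast; linarith)
  | succ i =>
    obtain ⟨R, hR, hR'⟩ := derivs f P h d hb he i
    obtain ⟨k, rfl⟩ : ∃ k, d = i + k := ⟨d - i, by omega⟩
    refine ⟨pderiv 1 P ^ (2 * k) * R, ?_, ?_⟩
    · exact ((hb.dy.pow (2 * k)).mul hR).mono (by push_cast; linarith)
        (by push_cast; linarith)
    · rw [map_mul, map_pow, ← hR']
      ring

lemma count (P : MvPolynomial (Fin 2) ℚ) (hP : P ≠ 0) (h d N : ℕ) (hb : Bd P h (d + 1))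
    (hN : N = h * (4 * d ^ 2 + 3 * d + 2))
    (Q : ℕ → MvPolynomial (Fin 2) ℚ)
    (hQ : ∀ i ≤ d + 1, Bd (Q i) ((2 * d + 1) * h) (d + 1 + d * (2 * d))) :
    ∃ (c : Fin (d + 2) × Fin (N + 1) → ℚ) (U : MvPolynomial (Fin 2) ℚ), c ≠ 0 ∧
      ∑ s, c s • (X 0 ^ (s.2 : ℕ) * Q s.1) = P * U := by
  let mon : Fin (N + 1 + 2 * d * h) × Fin (2 * d ^ 2 + 1) → MvPolynomial (Fin 2) ℚ :=
    fun t => monomial (Finsupp.single 0 (t.1 : ℕ) + Finsupp.single 1 (t.2 : ℕ)) 1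
  let Φ := (Fintype.linearCombination ℚ
      (fun s : Fin (d + 2) × Fin (N + 1) => X 0 ^ (s.2 : ℕ) * Q s.1)).coprod
    (-((LinearMap.mulLeft ℚ P).comp (Fintype.linearCombination ℚ mon)))
  let T : _ →ₗ[ℚ] (Fin (N + 1 + (2 * d + 1) * h) × Fin (2 * d ^ 2 + d + 2) → ℚ) :=
    (LinearMap.pi fun t => lcoeff ℚ (Finsupp.single 0 (t.1 : ℕ) + Finsupp.single 1 (t.2 : ℕ))).comp Φ
  have hT : LinearMap.ker T ≠ ⊥ := by
    apply LinearMap.ker_ne_bot_of_finrank_lt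
    simp only [Module.finrank_prod, Module.finrank_fintype_fun_eq_card, Fintype.card_prod,
      Fintype.card_fin]
    subst hN
    ring_nf
    omega
  obtain ⟨v, hv, hv0⟩ := (Submodule.ne_bot_iff _).1 hT
  obtain ⟨c, u⟩ := v
  have hΦ : Φ (c, u) = ∑ s, c s • (X 0 ^ (s.2 : ℕ) * Q s.1) - P * ∑ t, u t • mon t := by
    simp [Φ, Fintype.linearCombination_apply, sub_eq_add_neg, Finset.mul_sum]
  have hmon : ∀ t, Bd (mon t) (N + 2 * d * h) (2 * d ^ 2) := by
    intro t m hm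
    have h1 := t.1.2
    have h2 := t.2.2
    simp only [mon, coeff_monomial] at hm
    split_ifs at hm with hh
    · subst hh
      simp
      constructor <;> norm_cast <;> omega
    · exact absurd rfl hm
  have hbd : Bd (Φ (c, u)) (N + (2 * d + 1) * h) (2 * d ^ 2 + d + 1) := by
    rw [hΦ]
    refine Bd.sub (Bd.sum _ _ fun s _ => Bd.smul _ ?_) ?_
    · refine ((Bd.X0.pow s.2).mul (hQ s.1 (by omega))).mono ?_ (by linarith)
      have : ((s.2 : ℕ) : ℤ) ≤ N := by exact_mod_cast (by omega)
      linarith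
    · exact (hb.mul (Bd.sum _ _ fun t _ => Bd.smul _ (hmon t))).mono (by linarith) (by linarith)
  have hΦ0 : Φ (c, u) = 0 := by
    ext m
    rw [coeff_zero]
    by_contra hm
    have hm2 := hbd m hm
    have h1 : m 0 < N + 1 + (2 * d + 1) * h := by
      have := hm2.1
      norm_cast at this
      omega
    have h2 : m 1 < 2 * d ^ 2 + d + 2 := by
      have := hm2.2
      norm_cast at this
      omega
    have := congrFun (LinearMap.mem_ker.1 hv) (⟨m 0, h1⟩, ⟨m 1, h2⟩)
    apply hm
    have hmm : m = Finsupp.single 0 (m 0) + Finsupp.single 1 (m 1) := by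
      ext i; fin_cases i <;> simp
    rw [hmm]
    simpa [T] using this
  rw [hΦ, sub_eq_zero] at hΦ0
  refine ⟨c, _, ?_, hΦ0⟩
  rintro rfl
  apply hv0
  have h1 : P * ∑ t, u t • mon t = 0 := by rw [← hΦ0]; simp
  have h2 := (mul_eq_zero.1 h1).resolve_left hP
  have : u = 0 := by
    funext t
    have := congrArg (coeff (Finsupp.single 0 (t.1 : ℕ) + Finsupp.single 1 (t.2 : ℕ))) h2
    rw [coeff_sum, Finset.sum_eq_single t] at this
    · simpa [mon] using this
    · intro b _ hne
      have : ¬ ((Finsupp.single 0 (b.1 : ℕ) + Finsupp.single 1 (b.2 : ℕ) : Fin 2 →₀ ℕ) =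
        Finsupp.single 0 (t.1 : ℕ) + Finsupp.single 1 (t.2 : ℕ)) := by
        intro hh
        apply hne
        have e0 := DFunLike.congr_fun hh 0
        have e1 := DFunLike.congr_fun hh 1
        simp at e0 e1
        exact Prod.ext (Fin.ext e0) (Fin.ext e1)
      simp [mon, coeff_monomial, this]
    · simp
  simp [this]

end

open Finset

/-- Any algebraic power series is D-finite, with an annihilating linear
differential operator of order at most `deg_y P` and polynomial coefficients of degree
at most `4 * deg_x P * (deg_y P)^2`. -/
theorem algebraic_powerSeries_is_Dfinite
    (P : MvPolynomial (Fin 2) ℚ) (hP : P ≠ 0) (f : PowerSeries ℚ)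
    (hPf : MvPolynomial.aeval ![PowerSeries.X, f] P = 0) :
    ∃ r : ℕ, r ≤ P.degreeOf 1 ∧
      ∃ a : ℕ → Polynomial ℚ,
        (∃ i ≤ r, a i ≠ 0) ∧
        (∀ i ≤ r, (a i).natDegree ≤ 4 * P.degreeOf 0 * (P.degreeOf 1) ^ 2) ∧
        ∑ i ∈ range (r + 1),
          Polynomial.coeToPowerSeries.ringHom (a i) *
            (⇑(PowerSeries.derivative (R := ℚ)))^[i] f = 0 := by
  have hb := Bd_of_degreeOf P
  generalize P.degreeOf 0 = h at *
  generalize P.degreeOf 1 = D at *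
  obtain ⟨q, hq, hqb, hqe, hqd⟩ := exists_good f h D P hP hb hPf
  cases D with
  | zero =>
    refine absurd (base_case f q (fun m hm => ?_) hqe) hq
    simpa using (hqb m hm).2
  | succ d =>
    push_cast at hqb
    choose! Q hQ hQ' using fun i hi => derivs' f q h d hqb hqe i hi
    obtain ⟨N, hN⟩ : ∃ N, N = h * (4 * d ^ 2 + 3 * d + 2) := ⟨_, rfl⟩
    obtain ⟨c, U, hc, hU⟩ := count q hq h d N hqb hN Q hQ
    let a : ℕ → Polynomial ℚ := fun i => if hi : i < d + 2 then
      ∑ j : Fin (N + 1), Polynomial.monomial (j : ℕ) (c (⟨i, hi⟩, j)) else 0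
    refine ⟨d + 1, le_rfl, a, ?_, ?_, ?_⟩
    · obtain ⟨⟨i, j⟩, hij⟩ := Function.ne_iff.1 hc
      refine ⟨i, by omega, fun h0 => hij ?_⟩
      have := congrArg (fun p => Polynomial.coeff p (j : ℕ)) h0
      simpa [a, Polynomial.coeff_monomial, Fin.val_inj] using this
    · intro i hi
      have : N ≤ 4 * h * (d + 1) ^ 2 := by rw [hN]; nlinarith [Nat.zero_le (h * d)]
      refine le_trans ?_ this
      simp only [a, dif_pos (show i < d + 2 by omega)]
      refine Polynomial.natDegree_sum_le_of_forall_le _ _ fun j _ => ?_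
      exact (Polynomial.natDegree_monomial_le _).trans (by omega)
    · have h1 := congrArg (MvPolynomial.aeval ![PowerSeries.X, f]) hU
      rw [map_mul, hqe, zero_mul, map_sum, Fintype.sum_prod_type] at h1
      refine (mul_eq_zero.1 ?_).resolve_left (pow_ne_zero (2 * d + 1) hqd)
      rw [← h1, Finset.mul_sum, Finset.sum_range]
      refine Finset.sum_congr rfl fun i _ => ?_
      rw [mul_left_comm, hQ' i (by omega)]
      simp only [a, dif_pos i.2, map_sum, Finset.sum_mul]
      refine Finset.sum_congr rfl fun j _ => ?_
      simp [Polynomial.coe_monomial, PowerSeries.monomial_eq_mk, ← Polynomial.C_mul_X_pow_eq_monomial, PowerSeries.smul_eq_C_mul, mul_assoc]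
end

section
/- Let K be a field of characteristic zero equipped with a derivation d : K → K, let F be a subfield of K with d(F) ⊆ F, and let f, g ∈ K be algebraic over F with the same minimal polynomial over F. If a_0, …, a_r ∈ F satisfy a_r·d^r(f) + ⋯ + a_1·d(f) + a_0·f = 0, then also a_r·d^r(g) + ⋯ + a_1·d(g) + a_0·g = 0. In other words, every linear differential equation over F satisfied by f is satisfied by all conjugates of f over F. -/
open Polynomial in
theorem aux_deriv_poly
    (K : Type*) [Field K] (d : K → K)
    (hadd : ∀ x y : K, d (x + y) = d x + d y)
    (hmul : ∀ x y : K, d (x * y) = x * d y + d x * y)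
    (F : Subfield K) (hdF : ∀ x ∈ F, d x ∈ F) (p : F[X]) :
    ∃ q : F[X], ∀ x : K, d (aeval x p) = aeval x q + aeval x (derivative p) * d x := by
  induction p using Polynomial.induction_on with
  | C a =>
    refine ⟨C ⟨d a, hdF _ a.2⟩, fun x => ?_⟩
    simp only [aeval_C, derivative_C, map_zero, zero_mul, add_zero]
    rfl
  | add p q hp hq =>
    obtain ⟨p', hp⟩ := hp
    obtain ⟨q', hq⟩ := hq
    refine ⟨p' + q', fun x => ?_⟩
    simp only [map_add, hadd, hp, hq]
    ring
  | monomial n a h =>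
    obtain ⟨q, hq⟩ := h
    refine ⟨q * X, fun x => ?_⟩
    have e : (C a * X ^ (n + 1) : F[X]) = C a * X ^ n * X := by ring
    rw [e, derivative_mul (f := C a * X ^ n)]
    simp only [map_mul (aeval x) _ X, map_add, aeval_X, hmul _ x, hq, derivative_X, map_one]
    simp only [map_mul, map_one]
    ring

/-- Every linear differential equation over a differential subfield `F`
satisfied by `f` is satisfied by all conjugates of `f` over `F`. -/
theorem conjugates_satisfy_same_linear_ODE
    (K : Type*) [Field K] [CharZero K] (d : K → K)
    (hadd : ∀ x y : K, d (x + y) = d x + d y)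
    (hmul : ∀ x y : K, d (x * y) = x * d y + d x * y)
    (F : Subfield K) (hdF : ∀ x ∈ F, d x ∈ F)
    (f g : K) (hf : IsIntegral F f) (hg : IsIntegral F g)
    (hmin : minpoly F f = minpoly F g)
    (r : ℕ) (a : ℕ → K) (ha : ∀ i, a i ∈ F)
    (heq : ∑ i ∈ Finset.range (r + 1), a i * d^[i] f = 0) :
    ∑ i ∈ Finset.range (r + 1), a i * d^[i] g = 0 := by
  have hirr := minpoly.irreducible hf
  obtain ⟨u, v, huv⟩ := hirr.separable
  obtain ⟨q, hq⟩ := aux_deriv_poly K d hadd hmul F hdF (minpoly F f)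
  have d0 : d 0 = 0 := by simpa using hadd 0 0
  have key : ∀ x : K, Polynomial.aeval x (minpoly F f) = 0 →
      d x = Polynomial.aeval x (- (q * v)) := by
    intro x hx
    have h1 := hq x
    rw [hx, d0] at h1
    have h2 := congrArg (Polynomial.aeval x) huv
    simp only [map_add, map_mul, hx, map_one, mul_zero, zero_add] at h2
    simp only [map_neg, map_mul]
    linear_combination (-d x) * h2 - Polynomial.aeval x v * h1
  have hP : ∀ i : ℕ, ∃ P : Polynomial F, ∀ x : K, Polynomial.aeval x (minpoly F f) = 0 →
      d^[i] x = Polynomial.aeval x P := by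
    intro i
    induction i with
    | zero => exact ⟨Polynomial.X, fun x _ => by simp⟩
    | succ n ih =>
      obtain ⟨P, hP⟩ := ih
      obtain ⟨Q, hQ⟩ := aux_deriv_poly K d hadd hmul F hdF P
      refine ⟨Q + Polynomial.derivative P * (-(q * v)), fun x hx => ?_⟩
      rw [Function.iterate_succ_apply', hP x hx, hQ, map_add, map_mul, ← key x hx]
  choose P hP using hP
  have hS : ∀ x : K, Polynomial.aeval x (minpoly F f) = 0 →
      ∑ i ∈ Finset.range (r + 1), a i * d^[i] x = Polynomial.aeval x
        (∑ i ∈ Finset.range (r + 1), Polynomial.C (⟨a i, ha i⟩ : F) * P i) := by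
    intro x hx
    rw [map_sum]
    refine Finset.sum_congr rfl fun i _ => ?_
    rw [map_mul, Polynomial.aeval_C, hP i x hx]
    rfl
  have hgm : Polynomial.aeval g (minpoly F f) = 0 := by rw [hmin]; exact minpoly.aeval F g
  rw [hS g hgm]
  rw [hS f (minpoly.aeval F f)] at heq
  obtain ⟨t, ht⟩ := minpoly.dvd F f heq
  rw [ht, map_mul, hgm, zero_mul]
end

section
/- Let A_n = ∑_{k=0}^{n} C(n,k)^2 · C(n+k,k)^2 denote the n-th Apéry number, where C(m,j) is the binomial coefficient. Then A_0 = 1, A_1 = 5, and for every integer n ≥ 1, (n+1)^3 · A_{n+1} + n^3 · A_{n−1} = (2n+1)·(17n^2 + 17n + 5)·A_n. -/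
def apT (n k : ℕ) : ℚ := (n.choose k : ℚ) * ((n + k).choose k : ℚ)

lemma apT_zero (n : ℕ) : apT n 0 = 1 := by simp [apT]

lemma apT_gt (n k : ℕ) (h : n < k) : apT n k = 0 := by
  simp [apT, Nat.choose_eq_zero_of_lt h]

lemma ap_choose_right (n k : ℕ) :
    (n.choose (k + 1) : ℚ) * (k + 1) = n.choose k * ((n : ℚ) - k) := by
  rcases le_or_gt k n with h | h
  · have := Nat.choose_succ_right_eq n k
    have h2 : ((n.choose (k + 1) * (k + 1) : ℕ) : ℚ) = (n.choose k * (n - k) : ℕ) := by rw [this]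
    push_cast [Nat.cast_sub h] at h2
    exact h2
  · simp [Nat.choose_eq_zero_of_lt h, Nat.choose_eq_zero_of_lt (Nat.lt_succ_of_lt h)]

lemma ap_choose_up (n k : ℕ) :
    (n.choose k : ℚ) * (n + 1) = (n + 1).choose k * ((n : ℚ) + 1 - k) := by
  rcases le_or_gt k (n + 1) with h | h
  · have := Nat.choose_mul_succ_eq n k
    have h2 : ((n.choose k * (n + 1) : ℕ) : ℚ) = ((n + 1).choose k * (n + 1 - k) : ℕ) := by
      rw [this]
    push_cast [Nat.cast_sub h] at h2
    exact h2
  · simp [Nat.choose_eq_zero_of_lt h, Nat.choose_eq_zero_of_lt (show n < k by omega)]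

lemma apT_right (n k : ℕ) :
    ((k : ℚ) + 1) ^ 2 * apT n (k + 1) = ((n : ℚ) - k) * (n + k + 1) * apT n k := by
  have h1 := ap_choose_right n k
  have h2 : (((n + k + 1) * (n + k).choose k : ℕ) : ℚ)
      = ((n + k + 1).choose (k + 1) * (k + 1) : ℕ) := by
    exact_mod_cast Nat.add_one_mul_choose_eq (n + k) k
  push_cast at h2
  unfold apT
  rw [← add_assoc]
  linear_combination ((n + k + 1).choose (k + 1) : ℚ) * (k + 1) * h1
    - (n.choose k : ℚ) * ((n : ℚ) - k) * h2

lemma apT_up (n k : ℕ) :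
    ((n : ℚ) + 1 - k) * apT (n + 1) k = ((n : ℚ) + 1 + k) * apT n k := by
  have h1 := ap_choose_up n k
  have h2 := ap_choose_up (n + k) k
  push_cast at h2
  unfold apT
  rw [show n + 1 + k = n + k + 1 by ring]
  have hn : (n : ℚ) + 1 ≠ 0 := by positivity
  apply mul_left_cancel₀ hn
  linear_combination -((n + k + 1).choose k : ℚ) * (n + 1) * h1
    - (n.choose k : ℚ) * ((n : ℚ) + 1) * h2

lemma ap_sum (m N : ℕ) :
    ∑ k ∈ Finset.range (N + 1), (((m : ℚ) + 2) ^ 3 * apT (m + 2) k ^ 2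
      + ((m : ℚ) + 1) ^ 3 * apT m k ^ 2
      - (2 * m + 3) * (17 * ((m : ℚ) + 1) ^ 2 + 17 * (m + 1) + 5) * apT (m + 1) k ^ 2)
    = 4 * (2 * m + 3) * (N * (2 * N + 1) - (2 * (m : ℚ) + 3) ^ 2) * apT (m + 1) N ^ 2 := by
  induction N with
  | zero => simp [apT_zero]; ring
  | succ j ih =>
    rw [Finset.sum_range_succ, ih]
    have hj : (j : ℚ) + 1 ≠ 0 := by positivity
    obtain ⟨w, hw⟩ : ∃ w, apT (m + 1) j = ((j : ℚ) + 1) ^ 2 * w :=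
      ⟨apT (m + 1) j / ((j : ℚ) + 1) ^ 2, by field_simp⟩
    have a0 := apT_right m j
    have a1 := apT_right (m + 1) j
    have a2 := apT_right (m + 2) j
    have b0 := apT_up m j
    have b1 := apT_up (m + 1) j
    push_cast at a0 a1 a2 b0 b1
    have e1 : apT (m + 1) (j + 1) = ((m : ℚ) + 1 - j) * (m + 1 + j + 1) * w := by
      apply mul_left_cancel₀ (pow_ne_zero 2 hj)
      rw [a1, hw]; ring
    have e2 : apT (m + 2) (j + 1) = ((m : ℚ) + 2 + j) * (m + 3 + j) * w := by
      apply mul_left_cancel₀ (pow_ne_zero 2 hj)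
      rw [hw] at b1
      linear_combination a2 + ((m : ℚ) + 3 + j) * b1
    have e0 : apT m (j + 1) = ((m : ℚ) + 1 - j) * (m - j) * w := by
      apply mul_left_cancel₀ (pow_ne_zero 2 hj)
      rw [hw] at b0
      linear_combination a0 - ((m : ℚ) - j) * b0
    rw [e0, e1, e2, hw]
    push_cast
    ring

/-- The Apéry numbers satisfy Apéry's recurrence. -/
theorem apery_recurrence
    (A : ℕ → ℕ)
    (hA : ∀ n, A n = ∑ k ∈ Finset.range (n + 1),
      (n.choose k) ^ 2 * ((n + k).choose k) ^ 2) :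
    A 0 = 1 ∧ A 1 = 5 ∧
      ∀ n : ℕ, 1 ≤ n →
        (n + 1) ^ 3 * A (n + 1) + n ^ 3 * A (n - 1) =
          (2 * n + 1) * (17 * n ^ 2 + 17 * n + 5) * A n := by
  refine ⟨by simp [hA], by simp [hA, Finset.sum_range_succ], ?_⟩
  intro n hn
  obtain ⟨m, rfl⟩ : ∃ m, n = m + 1 := ⟨n - 1, by omega⟩
  have key : ∀ n M, n ≤ M → (A n : ℚ) = ∑ k ∈ Finset.range (M + 1), apT n k ^ 2 := by
    intro n M h
    rw [hA]
    push_cast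
    rw [← Finset.sum_subset (Finset.range_mono (Nat.succ_le_succ h))]
    · exact Finset.sum_congr rfl fun k _ => by unfold apT; ring
    · intro k _ hk
      rw [apT_gt n k (by simpa using hk)]; simp
  have h := ap_sum m (m + 2)
  rw [apT_gt (m + 1) (m + 2) (by omega), Finset.sum_sub_distrib, Finset.sum_add_distrib,
    ← Finset.mul_sum, ← Finset.mul_sum, ← Finset.mul_sum, ← key (m + 2) (m + 2) le_rfl,
    ← key m (m + 2) (by omega), ← key (m + 1) (m + 2) (by omega)] at h
  rw [Nat.add_sub_cancel, show m + 1 + 1 = m + 2 by ring]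
  have : (((m + 2) ^ 3 * A (m + 2) + (m + 1) ^ 3 * A m : ℕ) : ℚ) =
      ((2 * (m + 1) + 1) * (17 * (m + 1) ^ 2 + 17 * (m + 1) + 5) * A (m + 1) : ℕ) := by
    push_cast
    linear_combination h
  exact_mod_cast this
end

section
/- Let A_n = ∑_{k=0}^{n} C(n,k)^2 · C(n+k,k)^2 denote the n-th Apéry number and let f = ∑_{n≥0} A_n z^n ∈ ℚ[[z]]. Then, with f', f'', f''' denoting formal derivatives, the identity (z^4 − 34 z^3 + z^2)·f''' + (6 z^3 − 153 z^2 + 3 z)·f'' + (7 z^2 − 112 z + 1)·f' + (z − 5)·f = 0 holds in ℚ[[z]]. -/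
open PowerSeries

namespace AperyAux

def t (n k : ℕ) : ℚ := (n.choose k : ℚ) * ((n + k).choose k : ℚ)

lemma choose_right (n k : ℕ) :
    ((k : ℚ) + 1) * (n.choose (k + 1) : ℚ) = ((n : ℚ) - k) * n.choose k := by
  rcases le_or_gt k n with h | h
  · have := Nat.choose_succ_right_eq n k
    have h2 : ((n.choose (k+1) * (k+1) : ℕ) : ℚ) = ((n.choose k * (n - k) : ℕ) : ℚ) := by
      rw [this]
    push_cast [Nat.cast_sub h] at h2
    linarith
  · rw [Nat.choose_eq_zero_of_lt h, Nat.choose_eq_zero_of_lt (by omega)]; simp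

lemma choose_both (n k : ℕ) :
    ((k : ℚ) + 1) * ((n + 1).choose (k + 1) : ℚ) = ((n : ℚ) + 1) * n.choose k := by
  have := Nat.add_one_mul_choose_eq n k
  have h2 : (((n+1) * n.choose k : ℕ) : ℚ) = (((n+1).choose (k+1) * (k+1) : ℕ) : ℚ) := by
    rw [this]
  push_cast at h2
  linarith

lemma choose_up (n k : ℕ) :
    ((n : ℚ) + 1 - k) * ((n + 1).choose k : ℚ) = ((n : ℚ) + 1) * n.choose k := by
  rw [← choose_both, choose_right]; push_cast; ring

lemma ta (n j : ℕ) : ((j:ℚ)+1)^2 * t n (j+1) = ((n:ℚ)+j+1) * (n-j) * t n j := by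
  have h1 := choose_right n j
  have h2 := choose_both (n+j) j
  unfold t
  rw [← add_assoc]
  push_cast at h2
  linear_combination ((j:ℚ)+1) * ((n+j+1).choose (j+1) : ℚ) * h1 + ((n:ℚ)-j) * (n.choose j : ℚ) * h2

lemma tn (n j : ℕ) : ((n:ℚ)+1-j) * t (n+1) j = ((n:ℚ)+j+1) * t n j := by
  have h1 := choose_up n j
  have h2 := choose_up (n+j) j
  have h0 : (n:ℚ)+1 ≠ 0 := by positivity
  unfold t
  rw [show n+1+j = n+j+1 by ring]
  push_cast at h2
  apply mul_left_cancel₀ h0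
  linear_combination ((n:ℚ)+1) * ((n+j+1).choose j : ℚ) * h1 + ((n:ℚ)+1) * (n.choose j : ℚ) * h2

lemma tb (n j : ℕ) : ((j:ℚ)+1)^2 * t (n+1) (j+1) = ((n:ℚ)+j+2) * (n+j+1) * t n j := by
  have h1 := ta (n+1) j
  have h2 := tn n j
  push_cast at h1
  linear_combination h1 + ((n:ℚ)+j+2) * h2

lemma tc (n j : ℕ) : ((j:ℚ)+1)^2 * t n (j+1) = ((n:ℚ)+1-j) * (n-j) * t (n+1) j := by
  linear_combination ta n j - ((n:ℚ)-j) * tn n j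

def B (n k : ℕ) : ℚ := 4*(2*n+1)*(k*(2*k+1)-(2*n+1)^2) * t n k ^ 2

def R (m k : ℕ) : ℚ := ((m:ℚ)+2)^3 * t (m+2) k ^ 2
  - (34*((m:ℚ)+1)^3+51*((m:ℚ)+1)^2+27*((m:ℚ)+1)+5) * t (m+1) k ^ 2
  + ((m:ℚ)+1)^3 * t m k ^ 2

lemma step (m j : ℕ) : R m (j+1) = B (m+1) (j+1) - B (m+1) j := by
  have h0 : (j:ℚ)+1 ≠ 0 := by positivity
  obtain ⟨w, hw⟩ : ∃ w, t (m+1) j = ((j:ℚ)+1)^2 * w := ⟨t (m+1) j / ((j:ℚ)+1)^2, by field_simp⟩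
  have key : ∀ x y : ℚ, ((j:ℚ)+1)^2 * x = ((j:ℚ)+1)^2 * y → x = y :=
    fun x y h => mul_left_cancel₀ (pow_ne_zero 2 h0) h
  have e1 : t (m+1) (j+1) = ((m:ℚ)+j+2)*(m+1-j)*w := by
    apply key; rw [ta, hw]; push_cast; ring
  have e2 : t (m+2) (j+1) = ((m:ℚ)+j+3)*(m+j+2)*w := by
    apply key; rw [tb, hw]; push_cast; ring
  have e3 : t m (j+1) = ((m:ℚ)+1-j)*(m-j)*w := by
    apply key; rw [tc, hw]; ring
  unfold R B
  rw [e1, e2, e3, hw]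
  push_cast
  ring

lemma sumR (m N : ℕ) : ∑ k ∈ Finset.range (N+1), R m k = B (m+1) N := by
  induction N with
  | zero => simp [R, B, t]; ring
  | succ N ih => rw [Finset.sum_range_succ, ih, step]; ring

def A (n : ℕ) : ℚ := ((∑ k ∈ Finset.range (n + 1),
        (n.choose k) ^ 2 * ((n + k).choose k) ^ 2 : ℕ) : ℚ)

lemma A_eq (n N : ℕ) (h : n + 1 ≤ N) : A n = ∑ k ∈ Finset.range N, t n k ^ 2 := by
  unfold A t
  push_cast
  rw [← Finset.sum_subset (Finset.range_mono h)]
  · simp only [mul_pow]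
  · intro k _ hk
    rw [Nat.choose_eq_zero_of_lt (by simpa using hk)]; simp

lemma rec (m : ℕ) : ((m:ℚ)+2)^3 * A (m+2)
  - (34*((m:ℚ)+1)^3+51*((m:ℚ)+1)^2+27*((m:ℚ)+1)+5) * A (m+1) + ((m:ℚ)+1)^3 * A m = 0 := by
  have h := sumR m (m+2)
  have hB : B (m+1) (m+2) = 0 := by
    simp [B, t]
  rw [hB] at h
  rw [A_eq (m+2) (m+2+1) (by omega), A_eq (m+1) (m+2+1) (by omega), A_eq m (m+2+1) (by omega), ← h]
  simp only [R, Finset.sum_add_distrib, Finset.sum_sub_distrib, Finset.mul_sum]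

end AperyAux

/-- The Apéry power series satisfies the stated third-order linear ODE. -/
theorem apery_series_ODE
    (f : PowerSeries ℚ)
    (hf : f = PowerSeries.mk fun n =>
      ((∑ k ∈ Finset.range (n + 1),
        (n.choose k) ^ 2 * ((n + k).choose k) ^ 2 : ℕ) : ℚ))
    (D : PowerSeries ℚ → PowerSeries ℚ)
    (hD : D = ⇑(PowerSeries.derivative (R := ℚ))) :
    (X ^ 4 - 34 * X ^ 3 + X ^ 2) * D (D (D f))
      + (6 * X ^ 3 - 153 * X ^ 2 + 3 * X) * D (D f)
      + (7 * X ^ 2 - 112 * X + 1) * D f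
      + (X - 5) * f = 0 := by
  have hc : ∀ n, coeff n f = AperyAux.A n := by
    intro n; rw [hf, coeff_mk]; rfl
  have hd : ∀ g n, coeff n (D g) = coeff (n+1) g * ((n:ℚ)+1) := by
    intro g n; rw [hD]; exact coeff_derivative g n
  have e : (X ^ 4 - 34 * X ^ 3 + X ^ 2) * D (D (D f))
      + (6 * X ^ 3 - 153 * X ^ 2 + 3 * X) * D (D f)
      + (7 * X ^ 2 - 112 * X + 1) * D f
      + (X - 5) * f
      = X ^ 4 * D (D (D f)) - C (34:ℚ) * (X ^ 3 * D (D (D f))) + X ^ 2 * D (D (D f))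
      + C (6:ℚ) * (X ^ 3 * D (D f)) - C (153:ℚ) * (X ^ 2 * D (D f)) + C (3:ℚ) * (X ^ 1 * D (D f))
      + C (7:ℚ) * (X ^ 2 * D f) - C (112:ℚ) * (X ^ 1 * D f) + D f
      + X ^ 1 * f - C (5:ℚ) * f := by
    simp only [map_ofNat]; ring
  rw [e]
  ext n
  simp only [map_add, map_sub, coeff_C_mul, coeff_X_pow_mul', hd, hc, map_zero]
  rcases n with _ | _ | _ | _ | n
  · norm_num [AperyAux.A, Finset.sum_range_succ]
  · have := AperyAux.rec 0
    norm_num at this ⊢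
    linarith
  · have := AperyAux.rec 1
    norm_num at this ⊢
    linarith
  · have := AperyAux.rec 2
    norm_num at this ⊢
    linarith
  · have := AperyAux.rec (n+3)
    simp only [show 4 ≤ n+1+1+1+1 by omega, show 3 ≤ n+1+1+1+1 by omega,
      show 2 ≤ n+1+1+1+1 by omega, show 1 ≤ n+1+1+1+1 by omega, if_true,
      show n+1+1+1+1-4 = n by omega, show n+1+1+1+1-3 = n+1 by omega,
      show n+1+1+1+1-2 = n+2 by omega, show n+1+1+1+1-1 = n+3 by omega]
    simp only [add_assoc] at this ⊢
    norm_num at this ⊢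
    linear_combination this
end

section
/- Let m ≥ 0 and let p_0, p_1, …, p_m be natural numbers with p_0 ≥ 1. Define the power series f = ∑_{n≥0} S(n) z^n ∈ ℚ[[z]], where S(n) = ∑_{k=0}^{n} C(n,k)^{p_0} · C(n+k,k)^{p_1} · C(n+2k,k)^{p_2} ⋯ C(n+mk,k)^{p_m}. Then f is transcendental over ℚ(z) if and only if p_0 + p_1 + ⋯ + p_m > 2. -/
/-- A formal power series `f ∈ ℚ[[z]]` is algebraic if it cancels a nonzero
polynomial `P ∈ ℚ[z][Y]`. -/
def PowerSeries.IsAlgebraicSeries (f : PowerSeries ℚ) : Prop :=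
  ∃ P : Polynomial (Polynomial ℚ), P ≠ 0 ∧
    Polynomial.eval₂ Polynomial.coeToPowerSeries.ringHom f P = 0

namespace GA
open Polynomial Filter Topology

section
variable {QA : Type} [Field QA] [Algebra ℚ QA] [CharZero QA] [IsAlgClosure ℚ QA]

theorem powerset_map' {α β : Type*} (g : α → β) (s : Multiset α) :
    (s.map g).powerset = s.powerset.map (Multiset.map g) := by
  induction s using Multiset.induction_on with
  | empty => simp
  | cons a s ih =>
    simp [ih, Multiset.powerset_cons, Multiset.map_map]

theorem exp_subset (s : Multiset ℂ) :
    (s.map (fun x => 1 + Complex.exp x)).prod =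
      (s.powerset.map (fun u => Complex.exp u.sum)).sum := by
  induction s using Multiset.induction_on with
  | empty => simp
  | cons a s ih =>
    simp only [Multiset.map_cons, Multiset.prod_cons, ih, Multiset.powerset_cons,
      Multiset.map_add, Multiset.sum_add, Multiset.map_map, Function.comp_def,
      Multiset.sum_cons, Complex.exp_add, Multiset.sum_map_mul_left]
    ring

theorem isGal : IsGalois ℚ QA :=
  haveI := IsAlgClosure.normal ℚ QA
  {}

theorem fixed_int (x : QA)
    (hx : ∀ σ : QA ≃ₐ[ℚ] QA, σ x = x) (hi : IsIntegral ℤ x) :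
    ∃ z : ℤ, x = z := by
  have := isGal (QA := QA)
  have := IsAlgClosure.isAlgClosed ℚ (K := QA)
  obtain ⟨r, hr⟩ := (InfiniteGalois.mem_range_algebraMap_iff_fixed (k := ℚ) x).2 hx
  have : IsIntegral ℤ r := by
    rw [← hr] at hi
    exact (isIntegral_algebraMap_iff (algebraMap ℚ QA).injective).1 hi
  obtain ⟨z, hz⟩ := IsIntegrallyClosed.isIntegral_iff.1 this
  refine ⟨z, ?_⟩
  rw [← hr, ← hz]; simp

open Classical in
theorem map_filter_ne (t : Multiset QA)
    (σ : QA ≃ₐ[ℚ] QA) (h : t.map σ = t) :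
    (t.filter (· ≠ 0)).map σ = t.filter (· ≠ 0) := by
  conv_rhs => rw [← h]
  rw [Multiset.filter_map]
  congr 1
  apply Multiset.filter_congr
  intro x _
  simp

/-- clearing denominators -/
theorem exists_int_poly (t : Multiset QA)
    (h : ∀ σ : QA ≃ₐ[ℚ] QA, t.map σ = t) :
    ∃ (f : ℤ[X]) (N : ℤ), N ≠ 0 ∧
      f.map (algebraMap ℤ QA) =
        C (N : QA) * (t.map (fun b => X - C b)).prod := by
  have := isGal (QA := QA)
  have := IsAlgClosure.isAlgClosed ℚ (K := QA)
  set G := (t.map (fun b => X - C b)).prod with hG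
  have hfix : ∀ σ : QA ≃ₐ[ℚ] QA,
      G.map (σ : QA →+* QA) = G := by
    intro σ
    rw [hG, Polynomial.map_multiset_prod, Multiset.map_map]
    conv_rhs => rw [← h σ, Multiset.map_map]
    congr 1
    apply Multiset.map_congr rfl
    intro x _
    simp
  have hco : ∀ n, ∃ r : ℚ, algebraMap ℚ QA r = G.coeff n := by
    intro n
    apply (InfiniteGalois.mem_range_algebraMap_iff_fixed (k := ℚ) _).2
    intro σ
    have := congrArg (fun P => P.coeff n) (hfix σ)
    simpa using this
  have hl : G ∈ Polynomial.lifts (algebraMap ℚ QA) := by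
    rw [Polynomial.lifts_iff_coeff_lifts]
    intro n
    obtain ⟨r, hr⟩ := hco n
    exact ⟨r, hr⟩
  obtain ⟨G0, hG0⟩ := (Polynomial.mem_lifts _).1 hl
  obtain ⟨b, hb, hb'⟩ := IsLocalization.integerNormalization_spec (nonZeroDivisors ℤ) G0
  refine ⟨IsLocalization.integerNormalization (nonZeroDivisors ℤ) G0, b, ?_, ?_⟩
  · exact nonZeroDivisors.ne_zero hb
  · rw [← hG0]
    ext n
    have := congrArg (fun P => algebraMap ℚ QA (P.coeff n)) hb'
    simp only [coeff_map, coeff_C_mul]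
    simpa using this


open Classical in
theorem pi_transc_aux (QA : Type) [Field QA] [Algebra ℚ QA] [CharZero QA] [IsAlgClosure ℚ QA] :
    Transcendental ℚ Real.pi := by
  intro hpi
  have := isGal (QA := QA)
  have := IsAlgClosure.isAlgClosed ℚ (K := QA)
  have := IsAlgClosure.isAlgebraic (R := ℚ) (K := QA)
  -- θ = iπ algebraic
  have hth : IsAlgebraic ℚ ((Real.pi : ℂ) * Complex.I) := by
    have h1 : IsAlgebraic ℚ (Real.pi : ℂ) := by
      have := hpi.algebraMap (A := ℂ)
      simpa using this
    have h2 : IsAlgebraic ℚ Complex.I := by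
      refine ⟨X ^ 2 + 1, ?_, by simp⟩
      exact (monic_X_pow_add (n := 2) (p := (1 : ℚ[X])) (by simp)).ne_zero
    exact h1.mul h2
  let ι : QA →ₐ[ℚ] ℂ := IsAlgClosed.lift
  have hιinj : Function.Injective ι := ι.toRingHom.injective
  let q := minpoly ℚ ((Real.pi : ℂ) * Complex.I)
  have hq0 : q ≠ 0 := minpoly.ne_zero hth.isIntegral
  let s := q.aroots QA
  have hsι : s.map ι = q.aroots ℂ := by
    have hspl : (q.map (algebraMap ℚ QA)).Splits := IsAlgClosed.splits _
    have := hspl.roots_map (ι : QA →+* ℂ)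
    rw [Polynomial.map_map] at this
    have e : (ι : QA →+* ℂ).comp (algebraMap ℚ QA) = algebraMap ℚ ℂ :=
      ι.comp_algebraMap
    rw [e] at this
    exact this.symm
  have hsσ : ∀ σ : QA ≃ₐ[ℚ] QA, s.map σ = s := by
    intro σ
    have hspl : (q.map (algebraMap ℚ QA)).Splits := IsAlgClosed.splits _
    have := hspl.roots_map (σ : QA →+* QA)
    rw [Polynomial.map_map] at this
    have e : (σ : QA →+* QA).comp (algebraMap ℚ QA)
        = algebraMap ℚ QA := by
      ext; simp
    rw [e] at this
    exact this.symm
  have hprod : ((s.map ι).map (fun x => 1 + Complex.exp x)).prod = 0 := by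
    rw [hsι]
    apply Multiset.prod_eq_zero
    rw [Multiset.mem_map]
    refine ⟨(Real.pi : ℂ) * Complex.I, ?_, ?_⟩
    · rw [mem_aroots]; exact ⟨hq0, minpoly.aeval _ _⟩
    · rw [Complex.exp_pi_mul_I]; ring
  let t := s.powerset.map Multiset.sum
  have htσ : ∀ σ : QA ≃ₐ[ℚ] QA, t.map σ = t := by
    intro σ
    have : t.map σ = ((s.map σ).powerset).map Multiset.sum := by
      rw [powerset_map', Multiset.map_map, Multiset.map_map]
      apply Multiset.map_congr rfl
      intro x _
      simp [map_multiset_sum]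
    rw [this, hsσ]
  have htsum : (t.map (fun b => Complex.exp (ι b))).sum = 0 := by
    rw [exp_subset, powerset_map'] at hprod
    rw [← hprod, Multiset.map_map, Multiset.map_map]
    congr 1
    apply Multiset.map_congr rfl
    intro x _
    simp [map_multiset_sum]
  let t0 := t.filter (· ≠ 0)
  have ht0σ : ∀ σ : QA ≃ₐ[ℚ] QA, t0.map σ = t0 :=
    fun σ => map_filter_ne t σ (htσ σ)
  let a := t.count 0
  have ha : 0 < a := by
    rw [Multiset.count_pos]
    exact Multiset.mem_map.2 ⟨0, by simp, by simp⟩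
  have hsum0 : (a : ℂ) + (t0.map (fun b => Complex.exp (ι b))).sum = 0 := by
    rw [← htsum]
    have h1 : t = t.filter (· = 0) + t0 := by
      exact (Multiset.filter_add_not (· = 0) t).symm
    have h2 : t.filter (· = 0) = Multiset.replicate a 0 := by
      have := Multiset.filter_eq' t (0 : QA)
      convert this
    rw [h2] at h1
    conv_rhs => rw [h1]
    simp
  obtain ⟨f, N, hN, hf⟩ := exists_int_poly t0 ht0σ
  have hmonic : ((t0.map (fun b => X - C b)).prod).Monic :=
    monic_multiset_prod_of_monic _ _ (fun b _ => monic_X_sub_C b)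
  have hNA : (N : QA) ≠ 0 := by exact_mod_cast hN
  have hf0 : f ≠ 0 := by
    rintro rfl
    rw [Polynomial.map_zero] at hf
    exact mul_ne_zero (C_ne_zero.2 hNA) hmonic.ne_zero hf.symm
  have hlc : f.leadingCoeff = N := by
    have h1 := congrArg Polynomial.leadingCoeff hf
    rw [Polynomial.leadingCoeff_map_of_injective (RingHom.injective_int _), leadingCoeff_mul,
      leadingCoeff_C, hmonic.leadingCoeff, mul_one] at h1
    simpa using h1
  have hroot : ∀ b ∈ t0, aeval b f = 0 := by
    intro b hb
    rw [aeval_def, ← eval_map, hf, eval_mul, eval_multiset_prod]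
    apply mul_eq_zero_of_right
    apply Multiset.prod_eq_zero
    rw [Multiset.map_map, Multiset.mem_map]
    exact ⟨b, hb, by simp⟩
  have hfe : f.eval 0 ≠ 0 := by
    intro h
    have h1 : (f.map (algebraMap ℤ QA)).eval 0 = 0 := by
      have := congrArg (algebraMap ℤ QA) h
      rw [← Polynomial.eval_zero_map, map_zero] at this
      exact this
    rw [hf, eval_mul, eval_multiset_prod, mul_eq_zero] at h1
    rcases h1 with h1 | h1
    · simp [hN] at h1
    · rw [Multiset.prod_eq_zero_iff, Multiset.map_map, Multiset.mem_map] at h1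
      obtain ⟨b, hb, hb'⟩ := h1
      have : b ≠ 0 := (Multiset.mem_filter.1 hb).2
      simp at hb'
      exact this hb'
  obtain ⟨c, hc⟩ := LindemannWeierstrass.exp_polynomial_approx f hfe
  let d := f.natDegree
  -- integrality
  have hint : ∀ (e : ℕ) (g : ℤ[X]), g.natDegree ≤ e →
      ∃ z : ℤ, (N : QA) ^ e * (t0.map (fun b => aeval b g)).sum = z := by
    intro e g hg
    apply fixed_int
    · intro σ
      rw [map_mul, map_pow, map_intCast, map_multiset_sum, Multiset.map_map]
      congr 2
      conv_rhs => rw [← ht0σ σ, Multiset.map_map]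
      apply Multiset.map_congr rfl
      intro x _
      have := Polynomial.aeval_algHom_apply ((σ : QA →ₐ[ℚ] QA).restrictScalars ℤ) x g
      simpa using this.symm
    · rw [← Multiset.sum_map_mul_left]
      apply IsIntegral.multiset_sum
      intro y hy
      obtain ⟨b, hb, rfl⟩ := Multiset.mem_map.1 hy
      have hNb : IsIntegral ℤ ((N : QA) * b) := by
        have := isIntegral_leadingCoeff_smul f b (hroot b hb)
        rw [hlc] at this
        simpa using this
      rw [aeval_eq_sum_range' (Nat.lt_succ_of_le hg), Finset.mul_sum]
      apply IsIntegral.sum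
      intro i hi
      have hi' : i ≤ e := Nat.lt_succ_iff.1 (Finset.mem_range.1 hi)
      have : (N : QA) ^ e * g.coeff i • b ^ i
          = ((g.coeff i * N ^ (e - i) : ℤ) : QA) * (N * b) ^ i := by
        rw [← Nat.sub_add_cancel hi', pow_add]
        simp only [Nat.add_sub_cancel]
        push_cast
        rw [zsmul_eq_mul]
        ring
      rw [this]
      exact IsIntegral.mul (isIntegral_intCast _) (hNb.pow i)
  -- limit
  have hlim : Tendsto (fun k : ℕ => (Multiset.card t0 : ℝ) * |(N : ℝ)| ^ d * |c| *
      ((|(N : ℝ)| ^ d * |c|) ^ k / (k.factorial : ℝ))) atTop (𝓝 0) := by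
    have := (FloorSemiring.tendsto_pow_div_factorial_atTop (|(N : ℝ)| ^ d * |c|)).const_mul
      ((Multiset.card t0 : ℝ) * |(N : ℝ)| ^ d * |c|)
    simpa using this
  have hev := hlim.eventually (gt_mem_nhds (zero_lt_one))
  obtain ⟨K, hK⟩ := eventually_atTop.1 hev
  obtain ⟨P, hPge, hPp⟩ := Nat.exists_infinite_primes (K + (eval 0 f).natAbs + N.natAbs + a + 2)
  obtain ⟨n, hn, gp, hgp, hr⟩ := hc P (by omega) hPp
  have hP1 : 1 ≤ P := by omega
  obtain ⟨z, hz⟩ := hint (P * d) gp (hgp.trans (Nat.sub_le _ _))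
  have hz' : (N : ℂ) ^ (P * d) * (t0.map (fun b => aeval (ι b) gp)).sum = z := by
    have := congrArg ι hz
    rw [map_mul, map_pow, map_intCast, map_multiset_sum, Multiset.map_map, map_intCast] at this
    rw [← this]
    congr 2
    apply Multiset.map_congr rfl
    intro x _
    exact Polynomial.aeval_algHom_apply (ι.restrictScalars ℤ) x gp
  have hsumle : ‖(t0.map (fun b => n • Complex.exp (ι b) - P • aeval (ι b) gp)).sum‖ ≤
      (Multiset.card t0 : ℝ) * (c ^ P / (P - 1).factorial) := by
    have h1 : ∀ b ∈ t0, ‖n • Complex.exp (ι b) - P • aeval (ι b) gp‖ ≤ c ^ P / (P - 1).factorial := by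
      intro b hb
      apply hr
      rw [mem_aroots]
      refine ⟨hf0, ?_⟩
      have := Polynomial.aeval_algHom_apply (ι.restrictScalars ℤ) b f
      rw [hroot b hb] at this
      simpa using this
    refine (norm_multiset_sum_le _).trans ?_
    rw [Multiset.map_map]
    refine (Multiset.sum_le_card_nsmul _ (c ^ P / (P - 1).factorial) ?_).trans ?_
    · intro y hy
      obtain ⟨b, hb, rfl⟩ := Multiset.mem_map.1 hy
      exact h1 b hb
    · simp
  have hkey : (N : ℂ) ^ (P * d) * (t0.map (fun b => n • Complex.exp (ι b) - P • aeval (ι b) gp)).sum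
      = ((-(N ^ (P * d) * n * a) - P * z : ℤ) : ℂ) := by
    rw [Multiset.sum_map_sub]
    simp only [zsmul_eq_mul, nsmul_eq_mul, Multiset.sum_map_mul_left]
    have h2 : (t0.map (fun b => Complex.exp (ι b))).sum = -(a : ℂ) := by
      linear_combination hsum0
    rw [h2]
    push_cast
    rw [← hz']
    ring
  have hne : (-(N ^ (P * d) * n * a) - P * z : ℤ) ≠ 0 := by
    intro h0
    have hdvd : (P : ℤ) ∣ N ^ (P * d) * n * a := ⟨-z, by linear_combination -h0⟩
    have hPi : Prime (P : ℤ) := Nat.prime_iff_prime_int.1 hPp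
    rcases hPi.dvd_or_dvd hdvd with h | h
    · rcases hPi.dvd_or_dvd h with h | h
      · have := hPi.dvd_of_dvd_pow h
        have := Int.natAbs_dvd_natAbs.2 this
        have := Nat.le_of_dvd (Int.natAbs_pos.2 hN) this
        simp at this
        omega
      · exact hn h
    · have := Nat.le_of_dvd ha (by exact_mod_cast h)
      omega
  have h1le : (1 : ℝ) ≤ ‖((-(N ^ (P * d) * n * a) - P * z : ℤ) : ℂ)‖ := by
    rw [Complex.norm_intCast]
    exact_mod_cast Int.one_le_abs hne
  rw [← hkey, norm_mul, norm_pow, Complex.norm_intCast] at h1le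
  have hfin := hK (P - 1) (by omega)
  have : |(N : ℝ)| ^ (P * d) * ‖(t0.map (fun b => n • Complex.exp (ι b) - P • aeval (ι b) gp)).sum‖
      ≤ (Multiset.card t0 : ℝ) * |(N : ℝ)| ^ d * |c| *
      ((|(N : ℝ)| ^ d * |c|) ^ (P - 1) / ((P - 1).factorial : ℝ)) := by
    calc _ ≤ |(N : ℝ)| ^ (P * d) * ((Multiset.card t0 : ℝ) * (|c| ^ P / (P - 1).factorial)) := by
          refine mul_le_mul_of_nonneg_left (hsumle.trans ?_) (by positivity)
          refine mul_le_mul_of_nonneg_left ?_ (by positivity)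
          refine div_le_div_of_nonneg_right ?_ (by positivity)
          exact (le_abs_self _).trans (abs_pow c P).le
      _ = _ := by
          obtain ⟨Q, rfl⟩ : ∃ Q, P = Q + 1 := ⟨P - 1, by omega⟩
          simp only [Nat.add_sub_cancel]
          rw [mul_comm (Q + 1) d, pow_mul, pow_succ, pow_succ, mul_pow]
          ring
  linarith

end

theorem pi_transc : Transcendental ℚ Real.pi := by
  exact @pi_transc_aux (AlgebraicClosure ℚ) _ (AlgebraicClosure.instAlgebra ℚ) _ inferInstance

end GA
namespace GA
open Polynomial Filter Topology

theorem algSeries_iff (f : PowerSeries ℚ) :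
    f.IsAlgebraicSeries ↔ IsAlgebraic ℚ[X] f := by
  have h : (algebraMap ℚ[X] (PowerSeries ℚ)) = Polynomial.coeToPowerSeries.ringHom := by
    refine RingHom.ext fun q => ?_
    rw [PowerSeries.algebraMap_apply']; simp
  unfold PowerSeries.IsAlgebraicSeries IsAlgebraic
  simp only [aeval_def, h]

/-- fixed point -/
theorem exists_w (φ : ℚ[X]) : ∃ w : PowerSeries ℚ, w = PowerSeries.X * aeval w φ := by
  set T : PowerSeries ℚ → PowerSeries ℚ := fun y => PowerSeries.X * aeval y φ with hT
  have hcon : ∀ k y y', (PowerSeries.X : PowerSeries ℚ) ^ k ∣ y - y' →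
      (PowerSeries.X : PowerSeries ℚ) ^ (k + 1) ∣ T y - T y' := by
    intro k y y' h
    have h2 : y - y' ∣ aeval y φ - aeval y' φ := by
      have := Polynomial.sub_dvd_eval_sub y y' (φ.map (algebraMap ℚ (PowerSeries ℚ)))
      simpa only [eval_map_algebraMap] using this
    rw [hT]
    simp only
    rw [← mul_sub, pow_succ']
    exact mul_dvd_mul_left _ (h.trans h2)
  have hstep : ∀ k, (PowerSeries.X : PowerSeries ℚ) ^ k ∣ T^[k + 1] 0 - T^[k] 0 := by
    intro k
    induction k with
    | zero => simp
    | succ k ih =>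
      rw [Function.iterate_succ_apply' T (k + 1), Function.iterate_succ_apply' T k]
      rw [Function.iterate_succ_apply' T k] at ih
      exact hcon _ _ _ ih
  have hst : ∀ k l, (PowerSeries.X : PowerSeries ℚ) ^ k ∣ T^[k + l] 0 - T^[k] 0 := by
    intro k l
    induction l with
    | zero => simp
    | succ l ih =>
      have h1 := (pow_dvd_pow (PowerSeries.X : PowerSeries ℚ) (Nat.le_add_right k l)).trans (hstep (k + l))
      have := dvd_add h1 ih
      rw [sub_add_sub_cancel] at this
      exact this
  let w : PowerSeries ℚ := PowerSeries.mk fun n => PowerSeries.coeff n (T^[n + 1] 0)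
  have hw : ∀ k, (PowerSeries.X : PowerSeries ℚ) ^ k ∣ w - T^[k] 0 := by
    intro k
    rw [PowerSeries.X_pow_dvd_iff]
    intro n hn
    obtain ⟨l, rfl⟩ : ∃ l, k = n + 1 + l := ⟨k - (n + 1), by omega⟩
    have := (PowerSeries.X_pow_dvd_iff.1 (hst (n + 1) l)) n (by omega)
    rw [map_sub] at this ⊢
    simp only [w, PowerSeries.coeff_mk]
    linarith
  refine ⟨w, ?_⟩
  have : ∀ k, (PowerSeries.X : PowerSeries ℚ) ^ k ∣ w - T w := by
    intro k
    have h1 := hw (k + 1)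
    have h2 := hcon k _ _ (hw k)
    rw [← Function.iterate_succ_apply' T k] at h2
    have := dvd_sub h1 h2
    rw [sub_sub_sub_cancel_right] at this
    exact (pow_dvd_pow _ (Nat.le_succ k)).trans this
  have h0 : w - T w = 0 := by
    ext n
    rw [(PowerSeries.X_pow_dvd_iff.1 (this (n + 1))) n (by omega)]
    simp
  exact sub_eq_zero.1 h0

abbrev BB := PowerSeries (PowerSeries ℚ)

noncomputable def diag (F : BB) : PowerSeries ℚ :=
  PowerSeries.mk fun n => PowerSeries.coeff n (PowerSeries.coeff n F)

noncomputable def kap : PowerSeries ℚ →+* BB := PowerSeries.map PowerSeries.C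
noncomputable def rho : BB →+* BB := PowerSeries.rescale (PowerSeries.X : PowerSeries ℚ)
noncomputable def xx : BB := PowerSeries.C (PowerSeries.X : PowerSeries ℚ)

theorem diag_add (F G : BB) : diag (F + G) = diag F + diag G := by
  ext n; simp [diag]
theorem diag_sub (F G : BB) : diag (F - G) = diag F - diag G := by
  ext n; simp [diag]

theorem diag_iota (g : PowerSeries ℚ) (F : BB) : diag (rho (kap g) * F) = g * diag F := by
  ext n
  rw [diag, PowerSeries.coeff_mk, PowerSeries.coeff_mul, PowerSeries.coeff_mul, map_sum]
  apply Finset.sum_congr rfl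
  rintro ⟨i, j⟩ hij
  have hij' : i + j = n := Finset.HasAntidiagonal.mem_antidiagonal.1 hij
  simp only [rho, kap, diag, PowerSeries.coeff_mk, PowerSeries.coeff_rescale, PowerSeries.coeff_map]
  rw [mul_assoc, ← hij', add_comm i j, PowerSeries.coeff_X_pow_mul, PowerSeries.coeff_C_mul]

theorem diag_x (F : BB) : diag (xx * rho F) = 0 := by
  ext n
  simp only [diag, PowerSeries.coeff_mk, rho, xx, PowerSeries.coeff_C_mul,
    PowerSeries.coeff_rescale, map_zero]
  rw [← mul_assoc, ← pow_succ', PowerSeries.coeff_X_pow_mul']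
  simp

theorem diag_s_pow (k : ℕ) (F : BB) : (PowerSeries.X : PowerSeries ℚ) ^ k ∣ diag (PowerSeries.X ^ k * F) := by
  rw [PowerSeries.X_pow_dvd_iff]
  intro n hn
  simp only [diag, PowerSeries.coeff_mk, PowerSeries.coeff_X_pow_mul']
  rw [if_neg (by omega)]; simp

theorem diag_geom (w : PowerSeries ℚ) (G : BB)
    (hG : G * (1 - PowerSeries.X * rho (kap w)) = 1) : diag G = 1 := by
  have hrec : G = 1 + PowerSeries.X * rho (kap w) * G := by linear_combination hG
  have h1 : ∀ k, diag (PowerSeries.X ^ (k + 1) * G) = w * diag (PowerSeries.X ^ (k + 2) * G) := by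
    intro k
    conv_lhs => rw [hrec]
    rw [← diag_iota, mul_add, diag_add]
    have : diag (PowerSeries.X ^ (k + 1) * 1) = 0 := by
      ext n
      simp only [diag, PowerSeries.coeff_mk, mul_one, PowerSeries.coeff_X_pow, map_zero]
      split_ifs with h
      · rw [PowerSeries.coeff_one, if_neg (by omega)]
      · simp
    rw [this, zero_add]
    congr 1; ring
  have h2 : ∀ k, diag (PowerSeries.X ^ 1 * G) = w ^ k * diag (PowerSeries.X ^ (k + 1) * G) := by
    intro k
    induction k with
    | zero => simp
    | succ k ih => rw [ih, h1 k]; ring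
  have h3 : diag (PowerSeries.X ^ 1 * G) = 0 := by
    ext n
    have : (PowerSeries.X : PowerSeries ℚ) ^ (n + 1) ∣ diag (PowerSeries.X ^ 1 * G) := by
      rw [h2 n]
      exact Dvd.dvd.mul_left (diag_s_pow (n + 1) G) _
    rw [(PowerSeries.X_pow_dvd_iff.1 this) n (by omega)]
    simp
  rw [hrec, diag_add]
  have : PowerSeries.X * rho (kap w) * G = rho (kap w) * (PowerSeries.X ^ 1 * G) := by ring
  rw [this, diag_iota, h3, mul_zero, add_zero]
  ext n
  simp only [diag, PowerSeries.coeff_mk, PowerSeries.coeff_one]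
  split_ifs with h
  · simp [h]
  · simp

theorem lagrange_diag (φ : ℚ[X]) :
    IsAlgebraic ℚ[X] (PowerSeries.mk fun n => (φ ^ n).coeff n : PowerSeries ℚ) := by
  obtain ⟨w, hw⟩ := exists_w φ
  set p : (PowerSeries ℚ)[X] := X - C PowerSeries.X * φ.map (algebraMap ℚ (PowerSeries ℚ)) with hp
  have hroot : p.IsRoot w := by
    rw [IsRoot.def, hp]
    simp only [eval_sub, eval_X, eval_mul, eval_C, eval_map_algebraMap]
    rw [← hw]; ring
  obtain ⟨U, hU⟩ := dvd_iff_isRoot.2 hroot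
  obtain ⟨V, hV⟩ : X - C w ∣ U - C (U.eval w) := by
    rw [dvd_iff_isRoot]; simp
  -- U(w) = p'(w)
  have hUw : U.eval w = 1 - PowerSeries.X * aeval w (derivative φ) := by
    have h1 : (derivative p).eval w = U.eval w := by
      rw [hU]; simp
    rw [← h1, hp]
    rw [derivative_sub, derivative_C_mul, derivative_map, eval_sub, eval_mul, eval_map_algebraMap]
    simp
  -- w algebraic
  have hwalg : IsAlgebraic ℚ[X] w := by
    refine ⟨X - C X * φ.map C, ?_, ?_⟩
    · intro h
      have := congrArg (fun q => (Polynomial.map (evalRingHom (0 : ℚ)) q)) h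
      simp at this
    · simp only [map_sub, aeval_X, map_mul, aeval_C]
      have h1 : aeval w (φ.map C) = aeval w φ := by
        rw [← algebraMap_eq, aeval_map_algebraMap]
      have h2 : algebraMap ℚ[X] (PowerSeries ℚ) X = PowerSeries.X := by
        rw [PowerSeries.algebraMap_apply']; simp
      rw [h1, h2, ← hw, sub_self]
  have hXalg : IsAlgebraic ℚ[X] (PowerSeries.X : PowerSeries ℚ) := by
    have h2 : algebraMap ℚ[X] (PowerSeries ℚ) X = PowerSeries.X := by
      rw [PowerSeries.algebraMap_apply']; simp
    rw [← h2]; exact isAlgebraic_algebraMap _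
  have hUalg : IsAlgebraic ℚ[X] (U.eval w) := by
    rw [hUw]
    have : IsAlgebraic ℚ[X] (aeval w (derivative φ)) := by
      have h1 : aeval w (derivative φ) = aeval w ((derivative φ).map C) := by
        rw [← algebraMap_eq, aeval_map_algebraMap]
      rw [h1]
      exact Algebra.isAlgebraic_adjoin_singleton_iff.mpr hwalg _ (aeval_mem_adjoin_singleton _ _)
    exact (isAlgebraic_one).sub (hXalg.mul this)
  -- identities in BB
  set ev : (PowerSeries ℚ)[X] →+* BB := eval₂RingHom kap xx with hev
  set u := ev U with hu
  set v := ev V with hv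
  have e1 : ev p = xx - PowerSeries.X * aeval xx φ := by
    rw [hev, hp]
    simp only [coe_eval₂RingHom, eval₂_sub, eval₂_X, eval₂_mul, eval₂_C, eval₂_map]
    congr 2
    · simp [kap]
  have e2 : xx - PowerSeries.X * aeval xx φ = (xx - kap w) * u := by
    rw [← e1, hU, map_mul, hu]; congr 1; simp [hev]
  have e3 : u = kap (U.eval w) + (xx - kap w) * v := by
    have := congrArg ev hV
    rw [map_sub, map_mul] at this
    have h1 : ev (C (U.eval w)) = kap (U.eval w) := by simp [hev]
    have h2 : ev (X - C w) = xx - kap w := by simp [hev]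
    rw [h1, h2] at this
    linear_combination this
  have hw0 : PowerSeries.constantCoeff w = 0 := by
    rw [hw]; simp
  have hu0 : PowerSeries.constantCoeff u = 1 := by
    have := congrArg PowerSeries.constantCoeff e2
    have hk : PowerSeries.constantCoeff (kap w) = 0 := by
      rw [← PowerSeries.coeff_zero_eq_constantCoeff_apply, kap, PowerSeries.coeff_map,
        PowerSeries.coeff_zero_eq_constantCoeff_apply, hw0, map_zero]
    simp only [map_sub, map_mul, PowerSeries.constantCoeff_X, zero_mul, sub_zero, hk] at this
    have hx : PowerSeries.constantCoeff xx = PowerSeries.X := by simp [xx]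
    rw [hx] at this
    exact (mul_left_cancel₀ PowerSeries.X_ne_zero (by rw [mul_one]; exact this)).symm
  obtain ⟨ui, hui⟩ : ∃ ui, u * ui = 1 := by
    have : IsUnit u := by
      rw [PowerSeries.isUnit_iff_constantCoeff, hu0]; exact isUnit_one
    exact this.exists_right_inv
  obtain ⟨w1, hw1⟩ : PowerSeries.X ∣ w := PowerSeries.X_dvd_iff.2 hw0
  have rx : rho xx = xx := by
    ext n m
    simp only [rho, xx, PowerSeries.coeff_rescale, PowerSeries.coeff_C]
    split_ifs with h
    · simp [h]
    · simp
  have rX : rho (PowerSeries.X) = xx * PowerSeries.X := by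
    rw [rho, PowerSeries.rescale_X]; rfl
  have rφ : rho (aeval xx φ) = aeval xx φ := by
    have := Polynomial.aeval_algHom_apply (rho.toRatAlgHom) xx φ
    have h2 : rho.toRatAlgHom xx = xx := rx
    rw [h2] at this
    exact this.symm
  have rw1 : rho (kap w) = xx * PowerSeries.X * rho (kap w1) := by
    rw [hw1, map_mul, map_mul, ← rX]; congr 2; simp [kap]
  have hxx : xx ≠ 0 := by
    intro h
    have := congrArg PowerSeries.constantCoeff h
    simp [xx] at this
  have e4 : 1 - PowerSeries.X * aeval xx φ = (1 - PowerSeries.X * rho (kap w1)) * rho u := by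
    apply mul_left_cancel₀ hxx
    have := congrArg rho e2
    rw [map_mul, map_sub, map_sub, map_mul, rx, rX, rφ, rw1] at this
    linear_combination this
  set E : BB := PowerSeries.mk fun n => ((φ ^ n : ℚ[X]) : PowerSeries ℚ) with hE
  have hxφ : aeval xx φ = PowerSeries.C ((φ : ℚ[X]) : PowerSeries ℚ) := by
    have h1 := Polynomial.aeval_algHom_apply ((PowerSeries.C (R := PowerSeries ℚ)).toRatAlgHom)
      (PowerSeries.X : PowerSeries ℚ) φ
    have h2 : (PowerSeries.C (R := PowerSeries ℚ)).toRatAlgHom PowerSeries.X = xx := rfl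
    rw [h2] at h1
    rw [h1]
    have h3 : aeval (PowerSeries.X : PowerSeries ℚ) φ = (φ : PowerSeries ℚ) := by
      have h4 := Polynomial.aeval_algHom_apply (Polynomial.coeToPowerSeries.algHom (R := ℚ) ℚ) X φ
      simpa using h4
    rw [h3]; rfl
  have hE1 : E * (1 - PowerSeries.X * aeval xx φ) = 1 := by
    rw [hxφ]
    refine PowerSeries.ext fun n => ?_
    rw [mul_sub, mul_one, map_sub, ← mul_assoc, PowerSeries.coeff_mul_C]
    cases n with
    | zero => simp [hE]
    | succ n =>
      rw [PowerSeries.coeff_succ_mul_X]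
      simp [hE, PowerSeries.coeff_one, pow_succ]
  have hG : (E * rho u) * (1 - PowerSeries.X * rho (kap w1)) = 1 := by
    have := hE1
    rw [e4] at this
    linear_combination this
  have hDG := diag_geom w1 _ hG
  have hrui : rho u * rho ui = 1 := by rw [← map_mul, hui, map_one]
  have e5 : rho (kap (U.eval w)) * E = E * rho u - xx * rho (v * ui) := by
    have h1 := congrArg rho e3
    rw [map_add, map_mul, map_sub, rx, rw1] at h1
    have h2 : E * (1 - PowerSeries.X * rho (kap w1)) = rho ui := by
      linear_combination (rho ui) * hG - E * (1 - PowerSeries.X * rho (kap w1)) * hrui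
    rw [map_mul]
    linear_combination (-E) * h1 + (- xx * rho v) * h2
  have e6 : U.eval w * diag E = 1 := by
    rw [← diag_iota, e5, diag_sub, hDG, diag_x, sub_zero]
  have e7 : diag E = (PowerSeries.mk fun n => (φ ^ n).coeff n : PowerSeries ℚ) := by
    ext n
    simp only [diag, hE, PowerSeries.coeff_mk, Polynomial.coeff_coe]
  rw [← e7]
  refine IsAlgebraic.of_mul (y := U.eval w) ?_ hUalg (by rw [e6]; exact isAlgebraic_one)
  apply mem_nonZeroDivisors_of_ne_zero
  intro h
  rw [h, zero_mul] at e6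
  exact zero_ne_one e6

theorem coeff_phi (n j : ℕ) :
    ((((1 + X) * ((1 + X) ^ j + X)) ^ n : ℚ[X])).coeff n =
      ((∑ k ∈ Finset.range (n + 1), n.choose k * (n + j * k).choose k : ℕ) : ℚ) := by
  rw [mul_pow, add_pow ((1 + X : ℚ[X]) ^ j), Finset.mul_sum, finsetSum_coeff]
  push_cast
  apply Finset.sum_congr rfl
  intro k hk
  have hk' : k ≤ n := Nat.lt_succ_iff.1 (Finset.mem_range.1 hk)
  have : (1 + X : ℚ[X]) ^ n * (((1 + X) ^ j) ^ k * X ^ (n - k) * ((n.choose k : ℕ) : ℚ[X]))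
      = C ((n.choose k : ℕ) : ℚ) * ((1 + X) ^ (n + j * k) * X ^ (n - k)) := by
    rw [pow_add, pow_mul]; simp; ring
  rw [this, coeff_C_mul]
  congr 1
  have h2 : n = k + (n - k) := by omega
  conv_lhs => rw [h2]
  rw [Nat.add_sub_cancel_left, coeff_mul_X_pow, coeff_one_add_X_pow]
  congr 2
  omega

theorem alg_case (m : ℕ) (p : ℕ → ℕ) (hp0 : 1 ≤ p 0)
    (h : ∑ j ∈ Finset.range (m + 1), p j ≤ 2) :
    (PowerSeries.mk fun n =>
      ((∑ k ∈ Finset.range (n + 1),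
        ∏ j ∈ Finset.range (m + 1), ((n + j * k).choose k) ^ (p j) : ℕ) : ℚ)).IsAlgebraicSeries := by
  rw [algSeries_iff]
  rw [Finset.sum_range_succ'] at h
  -- either all others vanish, or exactly one equals 1
  by_cases hz : ∀ j ∈ Finset.range m, p (j + 1) = 0
  · have hprod : ∀ n k, ∏ j ∈ Finset.range (m + 1), ((n + j * k).choose k) ^ (p j)
        = (n.choose k) ^ (p 0) := by
      intro n k
      rw [Finset.prod_range_succ', Finset.prod_eq_one, one_mul]
      · simp
      · intro j hj; rw [hz j hj, pow_zero]
    simp only [hprod]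
    rcases (by omega : p 0 = 1 ∨ p 0 = 2) with h1 | h1
    · simp only [h1, pow_one, Nat.sum_range_choose]
      refine IsAlgebraic.of_mul (y := (1 - PowerSeries.C 2 * PowerSeries.X : PowerSeries ℚ)) ?_ ?_ ?_
      · apply mem_nonZeroDivisors_of_ne_zero
        intro h
        have := congrArg PowerSeries.constantCoeff h
        simp at this
      · have : (1 - PowerSeries.C 2 * PowerSeries.X : PowerSeries ℚ) = algebraMap ℚ[X] _ (1 - C 2 * X) := by
          rw [PowerSeries.algebraMap_apply']; simp
        rw [this]; exact isAlgebraic_algebraMap _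
      · have : (1 - PowerSeries.C 2 * PowerSeries.X : PowerSeries ℚ) *
            (PowerSeries.mk fun n => ((2 ^ n : ℕ) : ℚ)) = 1 := by
          ext n
          rw [sub_mul, one_mul, map_sub, mul_assoc, PowerSeries.coeff_C_mul]
          cases n with
          | zero => simp
          | succ n => rw [PowerSeries.coeff_succ_X_mul]; simp [PowerSeries.coeff_one, pow_succ]; ring
        rw [this]; exact isAlgebraic_one
    · have := lagrange_diag ((1 + X) * ((1 + X) ^ 0 + X))
      simp only [coeff_phi] at this
      simpa [h1, sq] using this
  · push Not at hz
    obtain ⟨j0, hj0, hne⟩ := hz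
    have hle : p (j0 + 1) ≤ ∑ j ∈ Finset.range m, p (j + 1) :=
      Finset.single_le_sum (f := fun j => p (j + 1)) (fun _ _ => Nat.zero_le _) hj0
    have h1 : p 0 = 1 := by omega
    have h2 : p (j0 + 1) = 1 := by omega
    have hrest : ∀ j ∈ Finset.range m, j ≠ j0 → p (j + 1) = 0 := by
      intro j hj hjne
      have : p (j + 1) + p (j0 + 1) ≤ ∑ j ∈ Finset.range m, p (j + 1) := by
        rw [← Finset.sum_pair (f := fun j => p (j + 1)) hjne]
        apply Finset.sum_le_sum_of_subset
        intro x hx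
        simp only [Finset.mem_insert, Finset.mem_singleton] at hx
        rcases hx with rfl | rfl <;> assumption
      omega
    have hprod : ∀ n k, ∏ j ∈ Finset.range (m + 1), ((n + j * k).choose k) ^ (p j)
        = n.choose k * (n + (j0 + 1) * k).choose k := by
      intro n k
      rw [Finset.prod_range_succ', Finset.prod_eq_single_of_mem j0 hj0]
      · rw [h2, h1]; simp [mul_comm]
      · intro j hj hjne; rw [hrest j hj hjne, pow_zero]
    simp only [hprod]
    have := lagrange_diag ((1 + X) * ((1 + X) ^ (j0 + 1) + X))
    simp only [coeff_phi] at this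
    exact this

end GA
namespace GA
open Polynomial Filter Topology

theorem alg_deriv_aux (f : PowerSeries ℚ) (hf : IsAlgebraic ℚ[X] f) (P : ℚ[X][X]) :
    ∃ b, IsAlgebraic ℚ[X] b ∧ PowerSeries.derivative ℚ (aeval f P) =
      b + aeval f (derivative P) * PowerSeries.derivative ℚ f := by
  induction P using Polynomial.induction_on' with
  | add P Q hP hQ =>
    obtain ⟨b, hb, h1⟩ := hP
    obtain ⟨c, hc, h2⟩ := hQ
    refine ⟨b + c, hb.add hc, ?_⟩
    simp only [map_add, h1, h2]; ring
  | monomial n a =>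
    refine ⟨algebraMap ℚ[X] _ (derivative a) * f ^ n, (isAlgebraic_algebraMap _).mul (hf.pow n), ?_⟩
    have h1 : PowerSeries.derivative ℚ (algebraMap ℚ[X] (PowerSeries ℚ) a) =
        algebraMap ℚ[X] (PowerSeries ℚ) (derivative a) := by
      rw [PowerSeries.algebraMap_apply', PowerSeries.algebraMap_apply']
      simp [PowerSeries.derivative_coe]
    rw [aeval_monomial, Derivation.leibniz, Derivation.leibniz_pow, h1, derivative_monomial,
      aeval_monomial]
    simp only [smul_eq_mul, nsmul_eq_mul, map_mul, map_natCast]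
    ring

theorem alg_deriv (f : PowerSeries ℚ) (hf : IsAlgebraic ℚ[X] f) :
    IsAlgebraic ℚ[X] (PowerSeries.derivative ℚ f) := by
  classical
  have hex : ∃ n : ℕ, ∃ P : ℚ[X][X], P ≠ 0 ∧ aeval f P = 0 ∧ P.natDegree = n := by
    obtain ⟨P, h, h'⟩ := hf; exact ⟨_, P, h, h', rfl⟩
  obtain ⟨P, hP0, hPf, hPn⟩ := Nat.find_spec hex
  have hmin := fun m => Nat.find_min hex (m := m)
  rw [← hPn] at hmin
  have hdeg : P.natDegree ≠ 0 := by
    intro h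
    rw [natDegree_eq_zero] at h
    obtain ⟨a, rfl⟩ := h
    rw [aeval_C, PowerSeries.algebraMap_apply'] at hPf
    apply hP0
    have : a = 0 := by simpa using hPf
    rw [this, C_0]
  have hd0 : derivative P ≠ 0 := by
    intro h
    exact hdeg (natDegree_eq_zero_of_derivative_eq_zero h)
  have hne : aeval f (derivative P) ≠ 0 := by
    intro h
    exact hmin (derivative P).natDegree (natDegree_derivative_lt hdeg) ⟨_, hd0, h, rfl⟩
  obtain ⟨b, hb, h1⟩ := alg_deriv_aux f hf P
  rw [hPf, map_zero] at h1
  have h2 : aeval f (derivative P) * PowerSeries.derivative ℚ f = -b := by linear_combination -h1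
  refine IsAlgebraic.of_mul (y := aeval f (derivative P)) (mem_nonZeroDivisors_of_ne_zero hne) ?_
    (by rw [h2]; exact hb.neg)
  exact Algebra.isAlgebraic_adjoin_singleton_iff.mpr hf _ (aeval_mem_adjoin_singleton _ _)

theorem alg_theta (a : ℕ → ℚ) (hf : IsAlgebraic ℚ[X] (PowerSeries.mk a)) (q : ℕ) :
    IsAlgebraic ℚ[X] (PowerSeries.mk fun n => (n : ℚ) ^ q * a n) := by
  induction q with
  | zero => simpa using hf
  | succ q ih =>
    have hX : IsAlgebraic ℚ[X] (PowerSeries.X : PowerSeries ℚ) := by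
      have h2 : algebraMap ℚ[X] (PowerSeries ℚ) X = PowerSeries.X := by
        rw [PowerSeries.algebraMap_apply']; simp
      rw [← h2]; exact isAlgebraic_algebraMap _
    have := hX.mul (alg_deriv _ ih)
    have e : (PowerSeries.mk fun n => (n : ℚ) ^ (q + 1) * a n) = PowerSeries.X *
        PowerSeries.derivative ℚ (PowerSeries.mk fun n => (n : ℚ) ^ q * a n) := by
      refine PowerSeries.ext fun n => ?_
      cases n with
      | zero => simp
      | succ n =>
        rw [PowerSeries.coeff_succ_X_mul, PowerSeries.coeff_derivative]
        simp only [PowerSeries.coeff_mk]; push_cast; ring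
    rw [e]; exact this

/-- evaluation -/
def Sm (x : ℝ) : Subring (PowerSeries ℚ) where
  carrier := {F | Summable fun n => ‖((PowerSeries.coeff n F : ℚ) : ℝ) * x ^ n‖}
  mul_mem' := by
    intro F G hF hG
    have := summable_norm_sum_mul_antidiagonal_of_summable_norm hF hG
    refine this.congr fun n => ?_
    rw [PowerSeries.coeff_mul]; push_cast
    rw [Finset.sum_mul]
    congr 1
    apply Finset.sum_congr rfl
    intro ij hij
    rw [← Finset.HasAntidiagonal.mem_antidiagonal.1 hij, pow_add]; ring
  one_mem' := by
    refine summable_of_finite_support ((Set.finite_singleton 0).subset ?_)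
    intro n hn
    by_contra h
    apply hn
    have h' : n ≠ 0 := h
    simp [PowerSeries.coeff_one, h']
  add_mem' := by
    intro F G hF hG
    refine Summable.of_nonneg_of_le (fun _ => norm_nonneg _) (fun n => ?_) (hF.add hG)
    simp only [map_add]; push_cast
    rw [add_mul]; exact norm_add_le _ _
  zero_mem' := by simpa using summable_zero
  neg_mem' := by
    intro F hF
    simpa using hF

noncomputable def evS (x : ℝ) : Sm x →+* ℝ where
  toFun F := ∑' n, ((PowerSeries.coeff n F.1 : ℚ) : ℝ) * x ^ n
  map_one' := by
    rw [tsum_eq_single 0]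
    · simp
    · intro n hn; simp [PowerSeries.coeff_one, hn]
  map_zero' := by simp
  map_mul' := by
    rintro ⟨F, hF⟩ ⟨G, hG⟩
    rw [tsum_mul_tsum_eq_tsum_sum_antidiagonal_of_summable_norm hF hG]
    apply tsum_congr
    intro n
    simp only [Subring.coe_mul, MulMemClass.mk_mul_mk]
    rw [PowerSeries.coeff_mul]; push_cast
    rw [Finset.sum_mul]
    apply Finset.sum_congr rfl
    intro ij hij
    rw [← Finset.HasAntidiagonal.mem_antidiagonal.1 hij, pow_add]; ring
  map_add' := by
    rintro ⟨F, hF⟩ ⟨G, hG⟩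
    rw [← Summable.tsum_add (Summable.of_norm hF) (Summable.of_norm hG)]
    apply tsum_congr
    intro n
    simp [add_mul]

theorem ev_poly (x : ℝ) (F : PowerSeries ℚ) (hF : F ∈ Sm x) (P : ℚ[X][X])
    (hP : aeval F P = 0) :
    eval₂ (aeval x : ℚ[X] →ₐ[ℚ] ℝ).toRingHom (∑' n, ((PowerSeries.coeff n F : ℚ) : ℝ) * x ^ n) P = 0 := by
  have hmem : ∀ a : ℚ[X], (algebraMap ℚ[X] (PowerSeries ℚ) a) ∈ Sm x := by
    intro a
    refine summable_of_finite_support ((Finset.finite_toSet a.support).subset ?_)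
    intro n hn
    by_contra h
    apply hn
    rw [PowerSeries.algebraMap_apply']
    simp only [Finset.mem_coe, mem_support_iff, not_not] at h
    simp [h]
  let c : ℚ[X] →+* Sm x := (algebraMap ℚ[X] (PowerSeries ℚ)).codRestrict (Sm x) hmem
  have h1 : eval₂ c ⟨F, hF⟩ P = 0 := by
    apply Subtype.ext
    have := hom_eval₂ P c (Sm x).subtype ⟨F, hF⟩
    rw [aeval_def] at hP
    exact this.trans hP
  have h2 := hom_eval₂ P c (evS x) ⟨F, hF⟩
  rw [h1, map_zero] at h2
  have h3 : (evS x).comp c = (aeval x : ℚ[X] →ₐ[ℚ] ℝ).toRingHom := by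
    apply Polynomial.ringHom_ext'
    · exact RingHom.ext_rat _ _
    · have hX : ∀ n, PowerSeries.coeff n (algebraMap ℚ[X] (PowerSeries ℚ) X) = if n = 1 then 1 else 0 := by
        intro n
        rw [PowerSeries.algebraMap_apply']
        simp [PowerSeries.coeff_X]
      have : (evS x) (c X) = x := by
        change ∑' n, ((PowerSeries.coeff n (algebraMap ℚ[X] (PowerSeries ℚ) X) : ℚ) : ℝ) * x ^ n = x
        rw [tsum_eq_single 1]
        · rw [hX]; simp
        · intro n hn; rw [hX]; simp [hn]
      simpa using this
  rw [h3] at h2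
  exact h2.symm

theorem strip {K : Type*} [Field K] (Q : K[X][X]) (hQ : Q ≠ 0) :
    ∃ (e : ℕ) (Q1 : K[X][X]), Q = (C X) ^ e * Q1 ∧ Q1.map (evalRingHom 0) ≠ 0 := by
  have hfin : FiniteMultiplicity (C X : K[X][X]) Q := by
    apply FiniteMultiplicity.of_not_isUnit _ hQ
    rw [isUnit_C]; exact not_isUnit_X
  obtain ⟨Q1, h1, h2⟩ := hfin.exists_eq_pow_mul_and_not_dvd
  refine ⟨_, Q1, h1, ?_⟩
  intro h
  apply h2
  rw [C_dvd_iff_dvd_coeff]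
  intro i
  rw [X_dvd_iff, coeff_zero_eq_eval_zero]
  have := congrArg (fun q => q.coeff i) h
  simpa using this

/-- Case B: power behaviour -/
theorem caseB {K : Type*} [Field K] [Algebra K ℝ] (Q : K[X][X]) (hQ : Q ≠ 0) (V : ℝ → ℝ) (L : ℝ)
    (hV : Tendsto V (𝓝[>] 0) (𝓝 L))
    (h : ∀ᶠ s in 𝓝[>] (0 : ℝ), eval₂ (aeval s : K[X] →ₐ[K] ℝ).toRingHom (V s) Q = 0) :
    IsAlgebraic K L := by
  obtain ⟨e, Q1, h1, h2⟩ := strip Q hQ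
  refine ⟨_, h2, ?_⟩
  have h3 : ∀ᶠ s in 𝓝[>] (0 : ℝ), eval₂ (aeval s : K[X] →ₐ[K] ℝ).toRingHom (V s) Q1 = 0 := by
    filter_upwards [h, self_mem_nhdsWithin] with s hs hpos
    rw [h1, eval₂_mul, eval₂_pow, eval₂_C] at hs
    rcases mul_eq_zero.1 hs with h | h
    · have hpos' : (0:ℝ) < s := hpos
      simp at h
      exact absurd h.1 hpos'.ne'
    · exact h
  have h4 : Tendsto (fun s => eval₂ (aeval s : K[X] →ₐ[K] ℝ).toRingHom (V s) Q1) (𝓝[>] 0)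
      (𝓝 (aeval L (Q1.map (evalRingHom 0)))) := by
    have e1 : aeval L (Q1.map (evalRingHom 0)) =
        ∑ i ∈ Finset.range (Q1.natDegree + 1), (aeval (0:ℝ) (Q1.coeff i)) * L ^ i := by
      rw [aeval_def, eval₂_map, eval₂_eq_sum_range]
      apply Finset.sum_congr rfl
      intro i _
      congr 1
      simp only [RingHom.comp_apply, coe_evalRingHom]
      have := aeval_algebraMap_apply_eq_algebraMap_eval (A := ℝ) (0 : K) (Q1.coeff i)
      rw [map_zero] at this
      exact this.symm
    rw [e1]
    simp only [eval₂_eq_sum_range]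
    apply tendsto_finsetSum
    intro i _
    refine Tendsto.mul ?_ (hV.pow i)
    have : Continuous fun s : ℝ => aeval s (Q1.coeff i) := (Q1.coeff i).continuous_aeval
    exact (this.tendsto 0).mono_left nhdsWithin_le_nhds
  have h5 : Tendsto (fun s => eval₂ (aeval s : K[X] →ₐ[K] ℝ).toRingHom (V s) Q1) (𝓝[>] 0) (𝓝 0) :=
    tendsto_const_nhds.congr' (h3.mono fun s hs => hs.symm)
  exact tendsto_nhds_unique h4 h5

/-- Case A: logarithmic behaviour -/
theorem caseA (Q : ℝ[X][X]) (hQ : Q ≠ 0) (g : ℝ → ℝ)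
    (hg : Tendsto g (𝓝[>] 0) atTop)
    (hg2 : ∀ i : ℕ, Tendsto (fun s => s * g s ^ i) (𝓝[>] 0) (𝓝 0))
    (h : ∀ᶠ s in 𝓝[>] (0 : ℝ), eval₂ (aeval s : ℝ[X] →ₐ[ℝ] ℝ).toRingHom (g s) Q = 0) :
    False := by
  obtain ⟨e, Q1, h1, h2⟩ := strip Q hQ
  have h3 : ∀ᶠ s in 𝓝[>] (0 : ℝ), eval₂ (aeval s : ℝ[X] →ₐ[ℝ] ℝ).toRingHom (g s) Q1 = 0 := by
    filter_upwards [h, self_mem_nhdsWithin] with s hs hpos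
    rw [h1, eval₂_mul, eval₂_pow, eval₂_C] at hs
    rcases mul_eq_zero.1 hs with h | h
    · have hpos' : (0:ℝ) < s := hpos
      simp at h
      exact absurd h.1 hpos'.ne'
    · exact h
  set q := Q1.map (evalRingHom (0:ℝ)) with hq
  have hdiff : ∀ s, eval (g s) q = eval₂ (aeval s : ℝ[X] →ₐ[ℝ] ℝ).toRingHom (g s) Q1 -
      ∑ i ∈ Finset.range (Q1.natDegree + 1), eval s (divX (Q1.coeff i)) * (s * g s ^ i) := by
    intro s
    rw [hq, eval_map, eval₂_eq_sum_range, eval₂_eq_sum_range, ← Finset.sum_sub_distrib]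
    apply Finset.sum_congr rfl
    intro i _
    have : eval s (Q1.coeff i) = eval s (divX (Q1.coeff i)) * s + eval 0 (Q1.coeff i) := by
      conv_lhs => rw [← divX_mul_X_add (Q1.coeff i)]
      simp [coeff_zero_eq_eval_zero]
    simp only [coe_evalRingHom, AlgHom.toRingHom_eq_coe, RingHom.coe_coe, coe_aeval_eq_eval]
    rw [this]; ring
  have hlim : Tendsto (fun s => eval (g s) q) (𝓝[>] 0) (𝓝 0) := by
    have hs : Tendsto (fun s => ∑ i ∈ Finset.range (Q1.natDegree + 1),
        eval s (divX (Q1.coeff i)) * (s * g s ^ i)) (𝓝[>] 0)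
        (𝓝 (∑ i ∈ Finset.range (Q1.natDegree + 1), eval 0 (divX (Q1.coeff i)) * 0)) := by
      apply tendsto_finsetSum
      intro i _
      refine Tendsto.mul ?_ (hg2 i)
      exact ((divX (Q1.coeff i)).continuous.tendsto 0).mono_left nhdsWithin_le_nhds
    have h5 : Tendsto (fun s => eval₂ (aeval s : ℝ[X] →ₐ[ℝ] ℝ).toRingHom (g s) Q1) (𝓝[>] 0) (𝓝 0) :=
      tendsto_const_nhds.congr' (h3.mono fun s hs => hs.symm)
    have := h5.sub hs
    simp only [mul_zero, Finset.sum_const_zero, sub_zero] at this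
    exact this.congr fun s => (hdiff s).symm
  by_cases hd : 0 < q.degree
  · have h6 := (q.abs_tendsto_atTop hd).comp hg
    have h7 := hlim.abs
    rw [abs_zero] at h7
    exact not_tendsto_nhds_of_tendsto_atTop h6 0 h7
  · have : q = C (q.coeff 0) := eq_C_of_degree_le_zero (not_lt.1 hd)
    rw [this] at hlim
    simp only [eval_C] at hlim
    have h8 := tendsto_nhds_unique hlim tendsto_const_nhds
    exact h2 (by rw [this, ← h8, C_0])

end GA
namespace GA
open Polynomial Filter Topology

theorem abel_aux (b c : ℕ → ℝ) (hb : ∀ n, 0 ≤ b n)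
    (hc : ∀ ε > 0, ∀ᶠ n in atTop, |c n| ≤ ε * b n)
    (hs : ∀ y, 0 ≤ y → y < 1 → Summable fun n => b n * y ^ n)
    (hB : Tendsto (fun y => ∑' n, b n * y ^ n) (𝓝[<] 1) atTop) :
    (∀ y, 0 ≤ y → y < 1 → Summable fun n => |c n * y ^ n|) ∧
    Tendsto (fun y => (∑' n, c n * y ^ n) / ∑' n, b n * y ^ n) (𝓝[<] 1) (𝓝 0) := by
  have key : ∀ ε > 0, ∃ N : ℕ, ∀ y, 0 ≤ y → y < 1 → ∀ n,
      |c n * y ^ n| ≤ (if n < N then |c n| else 0) + ε * (b n * y ^ n) := by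
    intro ε hε
    obtain ⟨N, hN⟩ := eventually_atTop.1 (hc ε hε)
    refine ⟨N, fun y hy0 hy1 n => ?_⟩
    rw [abs_mul, abs_of_nonneg (pow_nonneg hy0 n)]
    have h1 : y ^ n ≤ 1 := pow_le_one₀ hy0 hy1.le
    have h0 : 0 ≤ y ^ n := pow_nonneg hy0 n
    split_ifs with h
    · have := mul_le_of_le_one_right (abs_nonneg (c n)) h1
      have := mul_nonneg hε.le (mul_nonneg (hb n) h0)
      linarith
    · have := mul_le_mul_of_nonneg_right (hN n (not_lt.1 h)) h0
      linarith
  have hfin : ∀ N : ℕ, Summable fun n => (if n < N then |c n| else 0) := by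
    intro N
    apply summable_of_hasFiniteSupport
    refine (Finset.range N).finite_toSet.subset ?_
    intro n hn
    simp only [Function.mem_support, ne_eq, ite_eq_right_iff, Classical.not_imp] at hn
    simpa using hn.1
  have hsum : ∀ y, 0 ≤ y → y < 1 → Summable fun n => |c n * y ^ n| := by
    intro y hy0 hy1
    obtain ⟨N, hN⟩ := key 1 one_pos
    exact Summable.of_nonneg_of_le (fun _ => abs_nonneg _) (hN y hy0 hy1)
      ((hfin N).add ((hs y hy0 hy1).mul_left 1))
  refine ⟨hsum, ?_⟩
  rw [Metric.tendsto_nhds]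
  intro ε hε
  obtain ⟨N, hN⟩ := key (ε / 2) (by positivity)
  set K := ∑' n, (if n < N then |c n| else 0) with hK
  have hK0 : 0 ≤ K := tsum_nonneg fun n => by split_ifs <;> positivity
  have hI : ∀ᶠ y : ℝ in 𝓝[<] 1, 0 ≤ y := by
    have : ∀ᶠ y : ℝ in 𝓝 1, 0 ≤ y := (eventually_gt_nhds (by norm_num : (0:ℝ) < 1)).mono fun _ h => h.le
    exact this.filter_mono nhdsWithin_le_nhds
  filter_upwards [hI, self_mem_nhdsWithin, hB.eventually_gt_atTop (2 * K / ε),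
    hB.eventually_gt_atTop 0] with y hy0 hy1 hB1 hB0
  have h1 : |∑' n, c n * y ^ n| ≤ K + ε / 2 * ∑' n, b n * y ^ n := by
    have e1 := norm_tsum_le_tsum_norm (f := fun n => c n * y ^ n) (hsum y hy0 hy1)
    have e2 := Summable.tsum_le_tsum (hN y hy0 hy1) (hsum y hy0 hy1)
      ((hfin N).add ((hs y hy0 hy1).mul_left (ε / 2)))
    rw [Summable.tsum_add (hfin N) ((hs y hy0 hy1).mul_left (ε / 2)), tsum_mul_left] at e2
    exact e1.trans e2
  rw [dist_zero_right, norm_div, Real.norm_eq_abs, Real.norm_eq_abs, abs_of_pos hB0,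
    div_lt_iff₀ hB0]
  rw [div_lt_iff₀ hε] at hB1
  linarith

theorem abel (a b : ℕ → ℝ) (C : ℝ) (hb : ∀ n, 0 ≤ b n) (hb1 : ∀ᶠ n in atTop, 0 < b n)
    (hab : Tendsto (fun n => a n / b n) atTop (𝓝 C))
    (hs : ∀ y, 0 ≤ y → y < 1 → Summable fun n => b n * y ^ n)
    (hB : Tendsto (fun y => ∑' n, b n * y ^ n) (𝓝[<] 1) atTop) :
    (∀ y, 0 ≤ y → y < 1 → Summable fun n => |a n * y ^ n|) ∧
    Tendsto (fun y => (∑' n, a n * y ^ n) / ∑' n, b n * y ^ n) (𝓝[<] 1) (𝓝 C) := by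
  have hc : ∀ ε > 0, ∀ᶠ n in atTop, |a n - C * b n| ≤ ε * b n := by
    intro ε hε
    filter_upwards [Metric.tendsto_nhds.1 hab ε hε, hb1] with n h1 h2
    rw [Real.dist_eq] at h1
    have : a n - C * b n = (a n / b n - C) * b n := by field_simp
    rw [this, abs_mul, abs_of_pos h2]
    exact mul_le_mul_of_nonneg_right h1.le h2.le
  obtain ⟨h1, h2⟩ := abel_aux b (fun n => a n - C * b n) hb hc hs hB
  have hsa : ∀ y, 0 ≤ y → y < 1 → Summable fun n => |a n * y ^ n| := by
    intro y hy0 hy1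
    have e1 : Summable fun n => (a n - C * b n) * y ^ n := (h1 y hy0 hy1).of_abs
    have e2 : Summable fun n => C * (b n * y ^ n) := (hs y hy0 hy1).mul_left C
    have e3 : Summable fun n => a n * y ^ n := by
      refine (e1.add e2).congr fun n => ?_
      ring
    exact e3.abs
  refine ⟨hsa, ?_⟩
  have h3 := h2.add_const C
  rw [zero_add] at h3
  refine h3.congr' ?_
  have hI : ∀ᶠ y : ℝ in 𝓝[<] 1, 0 ≤ y := by
    have : ∀ᶠ y : ℝ in 𝓝 1, 0 ≤ y := (eventually_gt_nhds (by norm_num : (0:ℝ) < 1)).mono fun _ h => h.le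
    exact this.filter_mono nhdsWithin_le_nhds
  filter_upwards [hI, self_mem_nhdsWithin, hB.eventually_gt_atTop 0] with y hy0 hy1 hB0
  have e : ∑' n, (a n - C * b n) * y ^ n = (∑' n, a n * y ^ n) - C * ∑' n, b n * y ^ n := by
    rw [← tsum_mul_left, ← Summable.tsum_sub (hsa y hy0 hy1).of_abs ((hs y hy0 hy1).mul_left C)]
    apply tsum_congr; intro n; ring
  rw [e, sub_div, mul_div_assoc, div_self hB0.ne']
  ring

theorem log_series (y : ℝ) (h0 : 0 ≤ y) (h1 : y < 1) :
    HasSum (fun n : ℕ => (1 / (n : ℝ)) * y ^ n) (-Real.log (1 - y)) := by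
  have := Real.hasSum_pow_div_log_of_abs_lt_one (x := y) (by rw [abs_of_nonneg h0]; exact h1)
  rw [← hasSum_nat_add_iff' 1]
  simp only [Finset.range_one, Finset.sum_singleton, Nat.cast_zero, div_zero, zero_mul, sub_zero]
  have e : (fun n : ℕ => y ^ (n + 1) / ((n : ℝ) + 1)) = fun n : ℕ => 1 / ((n + 1 : ℕ) : ℝ) * y ^ (n + 1) := by
    funext n; push_cast; ring
  rw [e] at this
  exact this

theorem sqrt_series (y : ℝ) (h0 : 0 ≤ y) (h1 : y < 1) :
    HasSum (fun n : ℕ => ((n.centralBinom : ℝ) / 4 ^ n) * y ^ n) (1 / √(1 - y)) := by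
  have hc : ∀ n : ℕ, Ring.choose ((1/2 : ℝ) + n - 1) n = (n.centralBinom : ℝ) / 4 ^ n := by
    intro n
    rw [← Ring.multichoose_eq]
    have h := Ring.factorial_nsmul_multichoose_eq_ascPochhammer (1/2 : ℝ) n
    rw [ascPochhammer_smeval_eq_eval] at h
    have h2 : ∀ n : ℕ, (ascPochhammer ℝ n).eval (1/2) = n.factorial * ((n.centralBinom : ℝ) / 4 ^ n) := by
      intro n
      induction n with
      | zero => simp
      | succ n ih =>
        rw [ascPochhammer_succ_eval, ih]
        have := Nat.succ_mul_centralBinom_succ n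
        have h3 : ((n:ℝ) + 1) * ((n+1).centralBinom : ℝ) = 2 * (2 * n + 1) * n.centralBinom := by
          exact_mod_cast this
        rw [Nat.factorial_succ, pow_succ]; push_cast
        have h4 : (4:ℝ)^n ≠ 0 := by positivity
        field_simp
        linear_combination (-2) * h3
    rw [h2, nsmul_eq_mul] at h
    exact mul_left_cancel₀ (by positivity) h
  have := (Real.one_div_one_sub_rpow_hasFPowerSeriesOnBall_zero (1/2)).hasSum (y := y) (by
    simp [abs_of_nonneg h0, enorm, ← NNReal.coe_lt_coe]; exact h1)
  rw [Real.sqrt_eq_rpow]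
  simp only [zero_add, FormalMultilinearSeries.ofScalars_apply_eq, hc] at this
  simpa [smul_eq_mul] using this

theorem tendsto_one_sub : Tendsto (fun y : ℝ => 1 - y) (𝓝[<] 1) (𝓝[>] 0) := by
  apply tendsto_nhdsWithin_iff.2
  constructor
  · have : Tendsto (fun y : ℝ => 1 - y) (𝓝 1) (𝓝 (1 - 1)) := tendsto_const_nhds.sub tendsto_id
    rw [sub_self] at this
    exact this.mono_left nhdsWithin_le_nhds
  · filter_upwards [self_mem_nhdsWithin] with y hy
    simpa using hy

theorem tendsto_one_sub' : Tendsto (fun y : ℝ => 1 - y) (𝓝[>] 0) (𝓝[<] 1) := by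
  apply tendsto_nhdsWithin_iff.2
  constructor
  · have : Tendsto (fun y : ℝ => 1 - y) (𝓝 0) (𝓝 (1 - 0)) := tendsto_const_nhds.sub tendsto_id
    rw [sub_zero] at this
    exact this.mono_left nhdsWithin_le_nhds
  · filter_upwards [self_mem_nhdsWithin] with y hy
    simpa using hy

theorem ev_nonneg : ∀ᶠ y : ℝ in 𝓝[<] 1, 0 ≤ y := by
  have : ∀ᶠ y : ℝ in 𝓝 1, 0 ≤ y := (eventually_gt_nhds (by norm_num : (0:ℝ) < 1)).mono fun _ h => h.le
  exact this.filter_mono nhdsWithin_le_nhds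

/-- log case -/
theorem abel_log (a : ℕ → ℝ) (C : ℝ) (hC : 0 < C)
    (ha : Tendsto (fun n => a n * n) atTop (𝓝 C)) :
    (∀ y, 0 ≤ y → y < 1 → Summable fun n => |a n * y ^ n|) ∧
    Tendsto (fun s : ℝ => (∑' n, a n * (1 - s) ^ n)) (𝓝[>] 0) atTop ∧
    ∀ i : ℕ, Tendsto (fun s : ℝ => s * (∑' n, a n * (1 - s) ^ n) ^ i) (𝓝[>] 0) (𝓝 0) := by
  have hlog : Tendsto (fun s : ℝ => -Real.log s) (𝓝[>] 0) atTop :=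
    tendsto_neg_atBot_atTop.comp Real.tendsto_log_nhdsGT_zero
  have hB : Tendsto (fun y : ℝ => ∑' n : ℕ, (1 / (n : ℝ)) * y ^ n) (𝓝[<] 1) atTop := by
    refine (hlog.comp tendsto_one_sub).congr' ?_
    filter_upwards [ev_nonneg, self_mem_nhdsWithin] with y h0 h1
    exact (log_series y h0 h1).tsum_eq.symm
  obtain ⟨h1, h2⟩ := abel a (fun n => 1 / (n:ℝ)) C (fun n => by positivity)
    ((eventually_gt_atTop 0).mono fun n hn => by positivity)
    (ha.congr fun n => by simp) (fun y h0 h1 => (log_series y h0 h1).summable) hB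
  have h3 : Tendsto (fun s : ℝ => (∑' n, a n * (1 - s) ^ n) / -Real.log s) (𝓝[>] 0) (𝓝 C) := by
    refine (h2.comp tendsto_one_sub').congr' ?_
    filter_upwards [tendsto_one_sub'.eventually ev_nonneg, self_mem_nhdsWithin] with s h0 hs
    have hs' : (0:ℝ) < s := hs
    simp only [Function.comp_apply]
    rw [(log_series (1 - s) h0 (by linarith)).tsum_eq]
    simp
  have hne : ∀ᶠ s : ℝ in 𝓝[>] 0, -Real.log s ≠ 0 := (hlog.eventually_gt_atTop 0).mono fun _ h => h.ne'
  refine ⟨h1, ?_, ?_⟩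
  · refine (h3.pos_mul_atTop hC hlog).congr' ?_
    filter_upwards [hne] with s hs
    exact div_mul_cancel₀ _ hs
  · intro i
    have h4 : Tendsto (fun s : ℝ => s * (-Real.log s) ^ i) (𝓝[>] 0) (𝓝 0) := by
      have := (Real.tendsto_pow_mul_exp_neg_atTop_nhds_zero i).comp hlog
      refine this.congr' ?_
      filter_upwards [self_mem_nhdsWithin] with s hs
      have hs' : (0:ℝ) < s := hs
      simp only [Function.comp_apply, neg_neg, Real.exp_log hs']
      ring
    have h5 := h4.mul (h3.pow i)
    rw [zero_mul] at h5
    refine h5.congr' ?_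
    filter_upwards [hne] with s hs
    rw [div_pow]
    field_simp

theorem centralBinom_asymp :
    Tendsto (fun n : ℕ => (n.centralBinom : ℝ) / 4 ^ n * √n) atTop (𝓝 (1 / √Real.pi)) := by
  have hst := Stirling.tendsto_stirlingSeq_sqrt_pi
  have h2 : Tendsto (fun n : ℕ => 2 * n) atTop atTop := tendsto_id.const_mul_atTop' (by norm_num)
  have hpi : √Real.pi ≠ 0 := by positivity
  have h3 := (hst.comp h2).div (hst.pow 2) (by positivity)
  have e : √Real.pi / √Real.pi ^ 2 = 1 / √Real.pi := by field_simp
  rw [e] at h3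
  refine h3.congr' ?_
  filter_upwards [eventually_gt_atTop 0] with n hn
  have hn' : (0:ℝ) < n := by exact_mod_cast hn
  have hcb : (n.centralBinom : ℝ) * (n.factorial * n.factorial) = (2 * n).factorial := by
    have := Nat.choose_mul_factorial_mul_factorial (show n ≤ 2 * n by omega)
    rw [Nat.centralBinom_eq_two_mul_choose]
    have h : 2 * n - n = n := by omega
    rw [h] at this
    rw [← this]; push_cast; ring
  have hcb2 : (n.centralBinom : ℝ) = (2 * n).factorial / (n.factorial * n.factorial) := by
    rw [← hcb]; field_simp
  simp only [Function.comp_apply, Pi.div_apply, Stirling.stirlingSeq]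
  rw [hcb2]
  have hs1 : √(2 * ((2 * n : ℕ) : ℝ)) = 2 * √n := by
    push_cast
    rw [show (2:ℝ) * (2 * n) = 2 ^ 2 * n by ring, Real.sqrt_mul (by positivity), Real.sqrt_sq (by norm_num)]
  have hs2 : √(2 * (n : ℝ)) ^ 2 = 2 * n := Real.sq_sqrt (by positivity)
  have hs3 : √(n : ℝ) ^ 2 = n := Real.sq_sqrt (by positivity)
  have hs0 : (0:ℝ) < √(n : ℝ) := by positivity
  have he : (((2 * n : ℕ) : ℝ) / Real.exp 1) ^ (2 * n) = 4 ^ n * ((n / Real.exp 1) ^ n) ^ 2 := by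
    push_cast
    rw [← pow_mul, mul_comm n 2, mul_div_assoc, mul_pow, pow_mul]; norm_num
  rw [hs1, he]
  have hq : (0:ℝ) < (n / Real.exp 1) ^ n := by positivity
  set w := ((n:ℝ) / Real.exp 1) ^ n
  rw [div_pow, mul_pow, hs2]
  have hf : (0:ℝ) < n.factorial := by positivity
  have h4 : (0:ℝ) < 4 ^ n := by positivity
  field_simp
  rw [hs3]

/-- sqrt case -/
theorem abel_sqrt (a : ℕ → ℝ) (C : ℝ)
    (ha : Tendsto (fun n => a n * √n) atTop (𝓝 C)) :
    (∀ y, 0 ≤ y → y < 1 → Summable fun n => |a n * y ^ n|) ∧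
    Tendsto (fun s : ℝ => s * (∑' n, a n * (1 - s ^ 2) ^ n)) (𝓝[>] 0) (𝓝 (C * √Real.pi)) := by
  have hsq : Tendsto (fun s : ℝ => 1 / √s) (𝓝[>] 0) atTop := by
    have h1 : Tendsto (fun s : ℝ => √s) (𝓝[>] 0) (𝓝[>] 0) := by
      apply tendsto_nhdsWithin_iff.2
      constructor
      · have := (Real.continuous_sqrt.tendsto 0)
        rw [Real.sqrt_zero] at this
        exact this.mono_left nhdsWithin_le_nhds
      · filter_upwards [self_mem_nhdsWithin] with s hs
        exact Real.sqrt_pos.2 hs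
    refine (tendsto_inv_nhdsGT_zero.comp h1).congr fun s => ?_
    simp
  have hB : Tendsto (fun y : ℝ => ∑' n : ℕ, ((n.centralBinom : ℝ) / 4 ^ n) * y ^ n) (𝓝[<] 1) atTop := by
    refine (hsq.comp tendsto_one_sub).congr' ?_
    filter_upwards [ev_nonneg, self_mem_nhdsWithin] with y h0 h1
    exact (sqrt_series y h0 h1).tsum_eq.symm
  have hpi : (1 / √Real.pi) ≠ 0 := by positivity
  have hab : Tendsto (fun n : ℕ => a n / ((n.centralBinom : ℝ) / 4 ^ n)) atTop (𝓝 (C * √Real.pi)) := by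
    have := ha.div centralBinom_asymp hpi
    rw [div_div_eq_mul_div, div_one] at this
    refine this.congr' ?_
    filter_upwards [eventually_gt_atTop 0] with n hn
    have hn' : (0:ℝ) < n := by exact_mod_cast hn
    have : 0 < √(n:ℝ) := by positivity
    simp only [Pi.div_apply]
    field_simp
  obtain ⟨h1, h2⟩ := abel a (fun n => (n.centralBinom : ℝ) / 4 ^ n) (C * √Real.pi)
    (fun n => by positivity)
    (Eventually.of_forall fun n => by have := n.centralBinom_pos; positivity)
    hab (fun y h0 h1 => (sqrt_series y h0 h1).summable) hB
  refine ⟨h1, ?_⟩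
  have ht : Tendsto (fun s : ℝ => s ^ 2) (𝓝[>] 0) (𝓝[>] 0) := by
    apply tendsto_nhdsWithin_iff.2
    constructor
    · have := ((continuous_pow 2).tendsto (0:ℝ))
      rw [zero_pow two_ne_zero] at this
      exact this.mono_left nhdsWithin_le_nhds
    · filter_upwards [self_mem_nhdsWithin] with s hs
      have hs' : (0:ℝ) < s := hs
      exact pow_pos hs' 2
  refine (h2.comp (tendsto_one_sub'.comp ht)).congr' ?_
  filter_upwards [(tendsto_one_sub'.comp ht).eventually ev_nonneg, self_mem_nhdsWithin] with s h0 hs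
  have hs' : (0:ℝ) < s := hs
  simp only [Function.comp_apply] at h0 ⊢
  have : 0 < s ^ 2 := by positivity
  rw [(sqrt_series (1 - s ^ 2) h0 (by linarith)).tsum_eq]
  simp only [sub_sub_cancel, Real.sqrt_sq hs'.le, div_div_eq_mul_div, div_one]
  ring

end GA
namespace GA
open Polynomial Filter Topology

theorem aeval_inj {K : Type*} [Field K] [CharZero K] (l : K[X]) (c : ℕ) (hc : c ≠ 0) (hl : l.coeff c ≠ 0)
    (p : ℚ[X]) (hp : p ≠ 0) : aeval l p ≠ 0 := by
  intro h
  have e : aeval l p = (p.map (algebraMap ℚ K)).comp l := by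
    rw [comp, eval₂_map, aeval_def]; rfl
  rw [e, comp_eq_zero_iff] at h
  rcases h with h | h
  · exact hp ((Polynomial.map_eq_zero _).1 h)
  · apply hl
    rw [h.2, coeff_C, if_neg hc]

/-- membership and evaluation of rescaled series -/
theorem ev_resc (b : ℕ → ℚ) (ρ y : ℝ) (hρ : 0 < ρ)
    (hs : Summable fun n => |(b n / ρ ^ n) * y ^ n|) (P : ℚ[X][X])
    (hP : aeval (PowerSeries.mk b) P = 0) :
    eval₂ (aeval (ρ⁻¹ * y) : ℚ[X] →ₐ[ℚ] ℝ).toRingHom (∑' n, (b n / ρ ^ n : ℝ) * y ^ n) P = 0 := by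
  have e : ∀ n, ((PowerSeries.coeff n (PowerSeries.mk b) : ℚ) : ℝ) * (ρ⁻¹ * y) ^ n
      = (b n / ρ ^ n : ℝ) * y ^ n := by
    intro n
    rw [PowerSeries.coeff_mk, mul_pow, inv_pow]
    ring
  have := ev_poly (ρ⁻¹ * y) (PowerSeries.mk b) (by
    change Summable _
    refine hs.congr fun n => ?_
    rw [e]; rfl) P hP
  simpa only [e] using this

theorem transc_odd (S : ℕ → ℚ) (q : ℕ) (ρ C₀ : ℝ) (hρ : 0 < ρ) (hC : 0 < C₀)
    (h : Tendsto (fun n : ℕ => (S n : ℝ) / ρ ^ n * (n : ℝ) ^ (q + 1)) atTop (𝓝 C₀)) :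
    ¬ IsAlgebraic ℚ[X] (PowerSeries.mk S) := by
  intro halg
  obtain ⟨P, hP0, hP⟩ := alg_theta S halg q
  obtain ⟨h1, h2, h3⟩ := abel_log (fun n => (((n:ℚ) ^ q * S n : ℚ) : ℝ) / ρ ^ n) C₀ hC (by
    refine h.congr fun n => ?_
    push_cast; ring)
  set l : ℝ[X] := C ρ⁻¹ * (1 - X) with hl
  have hlc : l.coeff 1 ≠ 0 := by
    rw [hl, coeff_C_mul]
    simp [coeff_one, hρ.ne']
  let φ : ℚ[X] →ₐ[ℚ] ℝ[X] := aeval l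
  have hφ : ∀ s : ℝ, (aeval s : ℝ[X] →ₐ[ℝ] ℝ).toRingHom.comp φ.toRingHom =
      (aeval (ρ⁻¹ * (1 - s)) : ℚ[X] →ₐ[ℚ] ℝ).toRingHom := by
    intro s
    apply Polynomial.ringHom_ext'
    · exact RingHom.ext_rat _ _
    · simp [φ, hl]
  refine caseA (P.map φ.toRingHom) ?_ _ h2 h3 ?_
  · have hinj : Function.Injective φ.toRingHom := by
      rw [injective_iff_map_eq_zero]
      intro p hp
      by_contra hne
      exact aeval_inj l 1 one_ne_zero hlc p hne hp
    rwa [Ne, Polynomial.map_eq_zero_iff hinj]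
  · have hI : ∀ᶠ s : ℝ in 𝓝[>] 0, s ∈ Set.Ioo (0:ℝ) 1 := Ioo_mem_nhdsGT one_pos
    filter_upwards [hI] with s hs
    rw [eval₂_map, hφ]
    exact ev_resc _ ρ (1 - s) hρ (h1 (1 - s) (by linarith [hs.2]) (by linarith [hs.1])) P hP

theorem transc_even (S : ℕ → ℚ) (q : ℕ) (ρ A : ℝ) (hρ : 0 < ρ) (hA : 0 < A)
    (hρa : IsAlgebraic ℚ ρ) (hAa : IsAlgebraic ℚ A)
    (h : Tendsto (fun n : ℕ => (S n : ℝ) / ρ ^ n * √n ^ (2 * (q + 1) + 1)) atTop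
      (𝓝 (A / √(2 * Real.pi) ^ (2 * (q + 1) + 1)))) :
    ¬ IsAlgebraic ℚ[X] (PowerSeries.mk S) := by
  intro halg
  obtain ⟨P, hP0, hP⟩ := alg_theta S halg (q + 1)
  obtain ⟨h1, h2⟩ := abel_sqrt (fun n => (((n:ℚ) ^ (q + 1) * S n : ℚ) : ℝ) / ρ ^ n) _ (by
    refine h.congr fun n => ?_
    have : √(n:ℝ) ^ (2 * (q + 1) + 1) = (n:ℝ) ^ (q + 1) * √n := by
      rw [pow_succ, pow_mul, Real.sq_sqrt (by positivity)]
    rw [this]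
    push_cast; ring)
  set L := A / √(2 * Real.pi) ^ (2 * (q + 1) + 1) * √Real.pi with hL
  let K := algebraicClosure ℚ ℝ
  let r : K := ⟨ρ⁻¹, mem_algebraicClosure_iff.2 hρa.inv⟩
  have hr : algebraMap K ℝ r = ρ⁻¹ := rfl
  have hr0 : r ≠ 0 := by
    intro h
    have := congrArg (algebraMap K ℝ) h
    rw [hr, map_zero] at this
    exact (inv_ne_zero hρ.ne') this
  set l : K[X] := C r * (1 - X ^ 2) with hl
  have hlc : l.coeff 2 ≠ 0 := by
    rw [hl, coeff_C_mul]
    simp [coeff_one, hr0]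
  let φ : ℚ[X] →ₐ[ℚ] K[X] := aeval l
  have hφ : ∀ (s : ℝ) (p : ℚ[X]), (aeval s : K[X] →ₐ[K] ℝ) (φ p) = aeval (ρ⁻¹ * (1 - s ^ 2)) p := by
    intro s
    have : (aeval s : K[X] →ₐ[K] ℝ).toRingHom.comp φ.toRingHom =
      (aeval (ρ⁻¹ * (1 - s ^ 2)) : ℚ[X] →ₐ[ℚ] ℝ).toRingHom := by
      apply Polynomial.ringHom_ext'
      · exact RingHom.ext_rat _ _
      · simp [φ, hl, hr]
    intro p
    exact congrArg (fun f => f p) this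
  set d := P.natDegree with hd
  have hLalg : IsAlgebraic K L := by
    refine caseB (∑ i ∈ Finset.range (d + 1), monomial i (φ (P.coeff i) * X ^ (d - i))) ?_ _ L h2 ?_
    · intro h0
      have := congrArg (fun f => coeff f d) h0
      simp only [finsetSum_coeff, coeff_monomial, coeff_zero] at this
      rw [Finset.sum_ite_eq' (Finset.range (d+1)) d] at this
      rw [if_pos (by simp), Nat.sub_self, pow_zero, mul_one] at this
      exact aeval_inj l 2 two_ne_zero hlc _ (by
        rw [hd]; exact leadingCoeff_ne_zero.2 hP0) this
    · have hI : ∀ᶠ s : ℝ in 𝓝[>] 0, s ∈ Set.Ioo (0:ℝ) 1 := Ioo_mem_nhdsGT one_pos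
      filter_upwards [hI] with s hs
      have hs2 : 0 < s ^ 2 := pow_pos hs.1 2
      have hs3 : s ^ 2 < 1 := pow_lt_one₀ hs.1.le hs.2 two_ne_zero
      have := ev_resc _ ρ (1 - s ^ 2) hρ (h1 (1 - s ^ 2) (by linarith) (by linarith)) P hP
      rw [eval₂_eq_sum_range, ← hd] at this
      rw [eval₂_finsetSum]
      simp only [eval₂_monomial]
      have e := congrArg (fun z => s ^ d * z) this
      simp only [mul_zero, Finset.mul_sum] at e
      rw [← e]
      apply Finset.sum_congr rfl
      intro i hi
      have hid : i ≤ d := by simpa [Nat.lt_succ_iff] using hi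
      have hsd : s ^ d = s ^ (d - i) * s ^ i := by rw [← pow_add]; congr 1; omega
      have e2 : (aeval s : K[X] →ₐ[K] ℝ).toRingHom (φ (P.coeff i) * X ^ (d - i)) =
          aeval (ρ⁻¹ * (1 - s ^ 2)) (P.coeff i) * s ^ (d - i) := by
        have := hφ s (P.coeff i)
        change (aeval s : K[X] →ₐ[K] ℝ) _ = _
        rw [map_mul, this]; simp
      rw [e2, hsd, mul_pow]
      change _ = s ^ (d - i) * s ^ i * (aeval (ρ⁻¹ * (1 - s ^ 2)) (P.coeff i) * _)
      ring
  haveI : Algebra.IsAlgebraic ℚ K := algebraicClosure.isAlgebraic ℚ ℝ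
  have hLQ : IsAlgebraic ℚ L := hLalg.restrictScalars ℚ
  have hpi := Real.pi_pos
  have hs2 : √(2 * Real.pi) ^ (2 * (q + 1) + 1) = (2 * Real.pi) ^ (q + 1) * (√2 * √Real.pi) := by
    rw [pow_succ, pow_mul, Real.sq_sqrt (by positivity), Real.sqrt_mul (by norm_num)]
  have hL0 : 0 < L := by positivity
  have hpe : Real.pi ^ (q + 1) = A * (L * 2 ^ (q + 1) * √2)⁻¹ := by
    have h0 : 0 < √Real.pi := by positivity
    have : L * (2 ^ (q + 1) * Real.pi ^ (q + 1) * √2) = A := by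
      rw [hL, hs2, mul_pow]; field_simp
    rw [← this]; field_simp
  have h2a : IsAlgebraic ℚ (2:ℝ) := by
    have := isAlgebraic_algebraMap (R := ℚ) (A := ℝ) 2
    simpa using this
  have hsa : IsAlgebraic ℚ √2 := by
    have : IsAlgebraic ℚ (√2 ^ 2) := by rw [Real.sq_sqrt (by norm_num)]; exact h2a
    exact this.of_pow two_pos
  have : IsAlgebraic ℚ (Real.pi ^ (q + 1)) := by
    rw [hpe]
    exact hAa.mul ((hLQ.mul (h2a.pow _)).mul hsa).inv
  exact pi_transc (this.of_pow (Nat.succ_pos q))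

theorem transc (S : ℕ → ℚ) (d : ℕ) (hd : 2 ≤ d) (ρ A : ℝ) (hρ : 0 < ρ) (hA : 0 < A)
    (hρa : IsAlgebraic ℚ ρ) (hAa : IsAlgebraic ℚ A)
    (h : Tendsto (fun n : ℕ => (S n : ℝ) / ρ ^ n * √n ^ d) atTop
      (𝓝 (A / √(2 * Real.pi) ^ d))) :
    ¬ IsAlgebraic ℚ[X] (PowerSeries.mk S) := by
  have hpi := Real.pi_pos
  rcases Nat.even_or_odd' d with ⟨q, rfl | rfl⟩
  · obtain ⟨q, rfl⟩ : ∃ q', q = q' + 1 := ⟨q - 1, by omega⟩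
    refine transc_odd S q ρ (A / √(2 * Real.pi) ^ (2 * (q + 1))) hρ (by positivity) ?_
    refine h.congr fun n => ?_
    rw [pow_mul √(n:ℝ), Real.sq_sqrt (by positivity)]
  · obtain ⟨q, rfl⟩ : ∃ q', q = q' + 1 := ⟨q - 1, by omega⟩
    exact transc_even S q ρ A hρ hA hρa hAa h

end GA
namespace GA
open Polynomial Filter Topology

/-- y log y -/
noncomputable def psi (y : ℝ) : ℝ := y * Real.log y

noncomputable def fj (c x : ℝ) : ℝ := psi (1 + c * x) - psi x - psi (1 + (c - 1) * x)

theorem exp_psi (a : ℕ) : Real.exp (psi a) = (a : ℝ) ^ a := by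
  rcases Nat.eq_zero_or_pos a with rfl | h
  · simp [psi]
  · rw [psi, mul_comm, Real.exp_mul, Real.exp_log (by positivity), Real.rpow_natCast]

theorem psi_mul (n α : ℝ) (hn : 0 < n) : psi (n * α) = n * α * Real.log n + n * psi α := by
  rcases eq_or_ne α 0 with rfl | h
  · simp [psi]
  · rw [psi, psi, Real.log_mul hn.ne' h]; ring

theorem fj_scale (n x c : ℝ) (hn : 0 < n) :
    psi (n + c * (n * x)) - psi (n * x) - psi (n + (c - 1) * (n * x)) = n * fj c x := by
  have e1 : n + c * (n * x) = n * (1 + c * x) := by ring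
  have e2 : n + (c - 1) * (n * x) = n * (1 + (c - 1) * x) := by ring
  rw [e1, e2, psi_mul _ _ hn, psi_mul _ _ hn, psi_mul _ _ hn, fj]; ring

theorem choose_le_exp (a b : ℕ) :
    ((a + b).choose a : ℝ) ≤ Real.exp (psi (a + b) - psi a - psi b) := by
  rw [Real.exp_sub, Real.exp_sub, exp_psi, exp_psi]
  have h0 : Real.exp (psi (a + b)) = ((a : ℝ) + b) ^ (a + b) := by
    have := exp_psi (a + b)
    push_cast at this; exact this
  rw [h0]
  have ha : (0:ℝ) < (a:ℝ) ^ a := by rw [← exp_psi]; positivity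
  have hb : (0:ℝ) < (b:ℝ) ^ b := by rw [← exp_psi]; positivity
  rw [div_div, le_div_iff₀ (by positivity), add_pow]
  have := Finset.single_le_sum (s := Finset.range (a + b + 1))
    (f := fun i => (a:ℝ) ^ i * (b:ℝ) ^ (a + b - i) * ((a + b).choose i : ℝ))
    (fun i _ => by positivity) (a := a) (by simp)
  simp only [Nat.add_sub_cancel_left] at this
  linarith

theorem choose_stirling (a b : ℕ) (ha : 1 ≤ a) (hb : 1 ≤ b) :
    ((a + b).choose a : ℝ) = Stirling.stirlingSeq (a + b) / (Stirling.stirlingSeq a * Stirling.stirlingSeq b)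
      * √((a + b) / (2 * a * b)) * Real.exp (psi (a + b) - psi a - psi b) := by
  have ha' : (0:ℝ) < a := by exact_mod_cast ha
  have hb' : (0:ℝ) < b := by exact_mod_cast hb
  have hc : ((a + b).choose a : ℝ) = (a + b).factorial / (a.factorial * b.factorial) := by
    have := Nat.add_choose_mul_factorial_mul_factorial a b
    rw [← Nat.choose_symm_add] at this
    rw [← this]; push_cast
    field_simp
  have h0 : Real.exp (psi (a + b)) = ((a : ℝ) + b) ^ (a + b) := by
    have := exp_psi (a + b)
    push_cast at this; exact this
  rw [Real.exp_sub, Real.exp_sub, exp_psi, exp_psi, h0, hc]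
  simp only [Stirling.stirlingSeq, div_pow, Nat.cast_add]
  have hs : √(((a:ℝ) + b) / (2 * a * b)) = √(2 * ((a:ℝ) + b)) / (√(2 * a) * √(2 * b)) := by
    rw [← Real.sqrt_mul (by positivity), ← Real.sqrt_div (by positivity)]
    congr 1
    field_simp
  rw [hs]
  have h1 : 0 < √(2 * ((a:ℝ) + b)) := by positivity
  have h2 : 0 < √(2 * (a:ℝ)) := by positivity
  have h3 : 0 < √(2 * (b:ℝ)) := by positivity
  have h4 : 0 < Real.exp 1 := by positivity
  rw [pow_add (Real.exp 1)]
  have h5 : 0 < ((a:ℝ) + b) ^ (a + b) := by positivity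
  field_simp

theorem st_ratio_le (a b : ℕ) (ha : 1 ≤ a) (hb : 1 ≤ b) :
    Stirling.stirlingSeq (a + b) / (Stirling.stirlingSeq a * Stirling.stirlingSeq b) ≤ 1 := by
  have h1 : √Real.pi ≤ Stirling.stirlingSeq a := Stirling.sqrt_pi_le_stirlingSeq (by omega)
  have h2 : √Real.pi ≤ Stirling.stirlingSeq b := Stirling.sqrt_pi_le_stirlingSeq (by omega)
  have h3 : Stirling.stirlingSeq (a + b) ≤ Stirling.stirlingSeq a := by
    obtain ⟨a, rfl⟩ : ∃ a', a = a' + 1 := ⟨a - 1, by omega⟩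
    have := Stirling.stirlingSeq'_antitone (show a ≤ a + b by omega)
    simp only [Function.comp_apply, Nat.succ_eq_add_one] at this
    rwa [show a + 1 + b = a + b + 1 by ring]
  have h4 : 1 ≤ √Real.pi := by
    rw [Real.one_le_sqrt]; linarith [Real.pi_gt_three]
  have h5 : 0 < Stirling.stirlingSeq a := by linarith
  have h6 : 0 < Stirling.stirlingSeq b := by linarith
  rw [div_le_one (by positivity)]
  nlinarith

/-- Each factor: k ≤ n -/
theorem fac_le (n k j : ℕ) (hn : 1 ≤ n) (hk : k ≤ n) :
    ((n + j * k).choose k : ℝ) ≤ Real.exp (n * fj j (k / n)) := by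
  have hn' : (0:ℝ) < n := by exact_mod_cast hn
  have hle : k ≤ n + j * k := by omega
  have := choose_le_exp k (n + j * k - k)
  rw [Nat.add_sub_cancel' hle] at this
  rw [← fj_scale _ _ _ hn', mul_div_cancel₀ _ hn'.ne']
  have e1 : ((n + j * k - k : ℕ) : ℝ) = n + (j - 1) * k := by
    rw [Nat.cast_sub hle]; push_cast; ring
  rw [e1, show (k:ℝ) + (n + (j - 1) * k) = n + j * k by ring] at this
  exact this

noncomputable def Rst (n k j : ℕ) : ℝ :=
  Stirling.stirlingSeq (n + j * k) / (Stirling.stirlingSeq k * Stirling.stirlingSeq (n + j * k - k))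

noncomputable def gj (c x : ℝ) : ℝ := (1 + c * x) / (x * (1 + (c - 1) * x))

theorem fac_eq (n k j : ℕ) (hk0 : 1 ≤ k) (hk : k < n) :
    √n * ((n + j * k).choose k : ℝ) = Rst n k j * √(gj j (k / n) / 2) * Real.exp (n * fj j (k / n)) := by
  have hn' : (0:ℝ) < n := by exact_mod_cast (by omega : 0 < n)
  have hk' : (0:ℝ) < k := by exact_mod_cast hk0
  have hle : k ≤ n + j * k := by omega
  have := choose_stirling k (n + j * k - k) hk0 (by omega)
  rw [Nat.add_sub_cancel' hle] at this
  have e1 : ((n + j * k - k : ℕ) : ℝ) = n + (j - 1) * k := by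
    rw [Nat.cast_sub hle]; push_cast; ring
  rw [e1, show (k:ℝ) + (n + (j - 1) * k) = n + j * k by ring] at this
  rw [this, ← fj_scale _ _ _ hn', mul_div_cancel₀ _ hn'.ne', Rst]
  have hb : (0:ℝ) < n + (j - 1) * k := by
    rw [← e1]; exact_mod_cast (by omega : 0 < n + j * k - k)
  have e2 : gj j (k / n) / 2 = n * ((n + j * k) / (2 * k * (n + (j - 1) * k))) := by
    rw [gj]
    have : (0:ℝ) < 1 + (j - 1) * (k / n) := by
      have : (1:ℝ) + (j - 1) * (k / n) = (n + (j - 1) * k) / n := by field_simp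
      rw [this]; positivity
    field_simp
  rw [e2, Real.sqrt_mul hn'.le]
  ring

theorem Rst_le (n k j : ℕ) (hk0 : 1 ≤ k) (hk : k < n) : Rst n k j ≤ 1 := by
  have hle : k ≤ n + j * k := by omega
  have := st_ratio_le k (n + j * k - k) hk0 (by omega)
  rwa [Nat.add_sub_cancel' hle] at this

/-- full term -/
noncomputable def hh (m : ℕ) (p : ℕ → ℕ) (x : ℝ) : ℝ :=
  ∑ j ∈ Finset.range (m + 1), (p j : ℝ) * fj j x

noncomputable def TT (m : ℕ) (p : ℕ → ℕ) (n k : ℕ) : ℝ :=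
  ∏ j ∈ Finset.range (m + 1), ((n + j * k).choose k : ℝ) ^ (p j)

theorem exp_hh (m : ℕ) (p : ℕ → ℕ) (n x : ℝ) :
    Real.exp (n * hh m p x) = ∏ j ∈ Finset.range (m + 1), Real.exp (n * fj j x) ^ (p j) := by
  rw [hh, Finset.mul_sum, Real.exp_sum]
  apply Finset.prod_congr rfl
  intro j _
  rw [← Real.exp_nat_mul]; congr 1; ring

theorem TT_le (m : ℕ) (p : ℕ → ℕ) (n k : ℕ) (hn : 1 ≤ n) (hk : k ≤ n) :
    TT m p n k ≤ Real.exp (n * hh m p (k / n)) := by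
  rw [exp_hh, TT]
  apply Finset.prod_le_prod
  · intro j _; positivity
  · intro j _
    exact pow_le_pow_left₀ (by positivity) (fac_le n k j hn hk) _

theorem TT_eq (m : ℕ) (p : ℕ → ℕ) (n k : ℕ) (hk0 : 1 ≤ k) (hk : k < n) :
    √n ^ (∑ j ∈ Finset.range (m + 1), p j) * TT m p n k =
      (∏ j ∈ Finset.range (m + 1), (Rst n k j * √(gj j (k / n) / 2)) ^ (p j)) *
        Real.exp (n * hh m p (k / n)) := by
  rw [exp_hh, TT, ← Finset.prod_pow_eq_pow_sum, ← Finset.prod_mul_distrib, ← Finset.prod_mul_distrib]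
  apply Finset.prod_congr rfl
  intro j _
  rw [← mul_pow, ← mul_pow, fac_eq n k j hk0 hk]

theorem gj_le (j : ℕ) (x δ : ℝ) (hδ : 0 < δ) (h0 : δ ≤ x) (h1 : δ ≤ 1 - x) :
    0 ≤ gj j x ∧ gj j x ≤ (1 + j) / δ ^ 2 := by
  have hj : (0:ℝ) ≤ j := by positivity
  have hd : δ ≤ 1 + (j - 1) * x := by nlinarith
  have hn : 0 ≤ 1 + (j:ℝ) * x := by nlinarith
  constructor
  · rw [gj]
    exact div_nonneg hn (mul_nonneg (by linarith) (by linarith))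
  · rw [gj]
    apply div_le_div₀ (by positivity) (by nlinarith) (by positivity)
    rw [sq]; exact mul_le_mul h0 hd hδ.le (by linarith)

theorem TT_le2 (m : ℕ) (p : ℕ → ℕ) (δ : ℝ) (hδ : 0 < δ) :
    ∃ M : ℝ, 0 ≤ M ∧ ∀ n k : ℕ, 1 ≤ n → δ ≤ (k:ℝ) / n → δ ≤ 1 - (k:ℝ) / n →
    √n ^ (∑ j ∈ Finset.range (m + 1), p j) * TT m p n k ≤ M * Real.exp (n * hh m p (k / n)) := by
  refine ⟨∏ j ∈ Finset.range (m + 1), (1 * √((1 + j) / δ ^ 2)) ^ (p j), by positivity, ?_⟩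
  intro n k hn h0 h1
  have hn' : (0:ℝ) < n := by exact_mod_cast hn
  have hk0 : 1 ≤ k := by
    by_contra h
    have : k = 0 := by omega
    subst this
    simp at h0; linarith
  have hk1 : k < n := by
    have : (k:ℝ) / n < 1 := by linarith
    rw [div_lt_one hn'] at this
    exact_mod_cast this
  rw [TT_eq m p n k hk0 hk1]
  apply mul_le_mul_of_nonneg_right _ (by positivity)
  have hR : ∀ j, 0 ≤ Rst n k j := by
    intro j
    have : ∀ i, 0 ≤ Stirling.stirlingSeq i := by intro i; unfold Stirling.stirlingSeq; positivity
    rw [Rst]; exact div_nonneg (this _) (mul_nonneg (this _) (this _))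
  apply Finset.prod_le_prod
  · intro j _; exact pow_nonneg (mul_nonneg (hR j) (by positivity)) _
  · intro j _
    apply pow_le_pow_left₀ (mul_nonneg (hR j) (by positivity))
    apply mul_le_mul (Rst_le n k j hk0 hk1) _ (by positivity) (by norm_num)
    apply Real.sqrt_le_sqrt
    have := gj_le j _ δ hδ h0 h1
    linarith

end GA
namespace GA
open Polynomial Filter Topology

noncomputable def dfj (c x : ℝ) : ℝ :=
  c * Real.log (1 + c * x) - Real.log x - (c - 1) * Real.log (1 + (c - 1) * x)
noncomputable def d2fj (c x : ℝ) : ℝ := -(1 / (x * (1 + c * x) * (1 + (c - 1) * x)))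

theorem hasDerivAt_psi_lin (c x : ℝ) (h : 0 < 1 + c * x) :
    HasDerivAt (fun x => psi (1 + c * x)) (c * (Real.log (1 + c * x) + 1)) x := by
  have h1 : HasDerivAt (fun x : ℝ => 1 + c * x) c x := by
    simpa using ((hasDerivAt_id x).const_mul c).const_add 1
  have h2 := (Real.hasDerivAt_mul_log h.ne').comp x h1
  rw [mul_comm]
  exact h2

theorem hasDerivAt_fj (j : ℕ) (x : ℝ) (h0 : 0 < x) (h1 : x < 1) :
    HasDerivAt (fj j) (dfj j x) x := by
  have hj : (0:ℝ) ≤ j := by positivity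
  have e1 := hasDerivAt_psi_lin j x (by positivity)
  have e2 := hasDerivAt_psi_lin (j - 1) x (by nlinarith)
  have e3 : HasDerivAt psi (Real.log x + 1) x := Real.hasDerivAt_mul_log h0.ne'
  have := (e1.sub e3).sub e2
  refine this.congr_deriv ?_
  rw [dfj]; ring

theorem hasDerivAt_log_lin (c x : ℝ) (h : 0 < 1 + c * x) :
    HasDerivAt (fun x => Real.log (1 + c * x)) (c / (1 + c * x)) x := by
  have h1 : HasDerivAt (fun x : ℝ => 1 + c * x) c x := by
    simpa using ((hasDerivAt_id x).const_mul c).const_add 1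
  exact h1.log h.ne'

theorem hasDerivAt_dfj (j : ℕ) (x : ℝ) (h0 : 0 < x) (h1 : x < 1) :
    HasDerivAt (dfj j) (d2fj j x) x := by
  have hj : (0:ℝ) ≤ j := by positivity
  have p1 : 0 < 1 + (j:ℝ) * x := by positivity
  have p2 : 0 < 1 + ((j:ℝ) - 1) * x := by nlinarith
  have e1 := (hasDerivAt_log_lin j x p1).const_mul (j:ℝ)
  have e2 := (hasDerivAt_log_lin (j - 1) x p2).const_mul ((j:ℝ) - 1)
  have := (e1.sub (Real.hasDerivAt_log h0.ne')).sub e2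
  refine this.congr_deriv ?_
  rw [d2fj]
  have hd : ((j:ℝ) - 1) = j - 1 := rfl
  generalize hdd : ((j:ℝ) - 1) = d at p2 ⊢
  have hjd : (j:ℝ) = d + 1 := by linarith
  rw [hjd] at p1 ⊢
  have p1' := p1.ne'
  have p2' := p2.ne'
  field_simp
  ring

theorem continuous_fj (c : ℝ) : Continuous (fj c) := by
  have : Continuous psi := Real.continuous_mul_log
  unfold fj
  fun_prop

theorem d2fj_neg (j : ℕ) (x : ℝ) (h0 : 0 < x) (h1 : x < 1) : d2fj j x ≤ 0 := by
  have hj : (0:ℝ) ≤ j := by positivity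
  have p1 : 0 < 1 + (j:ℝ) * x := by positivity
  have p2 : 0 < 1 + ((j:ℝ) - 1) * x := by nlinarith
  rw [d2fj, neg_nonpos]; positivity

theorem d2fj_zero (x : ℝ) (h0 : 0 < x) (h1 : x < 1) : d2fj 0 x ≤ -4 := by
  rw [d2fj, neg_le_neg_iff]
  have : 0 < x * (1 - x) := mul_pos h0 (by linarith)
  rw [show x * (1 + 0 * x) * (1 + (0 - 1) * x) = x * (1 - x) by ring, le_div_iff₀ this]
  nlinarith [sq_nonneg (2 * x - 1)]

noncomputable def dhh (m : ℕ) (p : ℕ → ℕ) (x : ℝ) : ℝ :=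
  ∑ j ∈ Finset.range (m + 1), (p j : ℝ) * dfj j x
noncomputable def d2hh (m : ℕ) (p : ℕ → ℕ) (x : ℝ) : ℝ :=
  ∑ j ∈ Finset.range (m + 1), (p j : ℝ) * d2fj j x

theorem hasDerivAt_hh (m p) (x : ℝ) (h0 : 0 < x) (h1 : x < 1) :
    HasDerivAt (hh m p) (dhh m p x) x := by
  have := HasDerivAt.fun_sum (u := Finset.range (m + 1)) (x := x)
    (A := fun (j:ℕ) x => (p j : ℝ) * fj j x) (A' := fun j => (p j : ℝ) * dfj j x)
    (fun j _ => (hasDerivAt_fj j x h0 h1).const_mul _)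
  exact this

theorem hasDerivAt_dhh (m p) (x : ℝ) (h0 : 0 < x) (h1 : x < 1) :
    HasDerivAt (dhh m p) (d2hh m p x) x := by
  have := HasDerivAt.fun_sum (u := Finset.range (m + 1)) (x := x)
    (A := fun (j:ℕ) x => (p j : ℝ) * dfj j x) (A' := fun j => (p j : ℝ) * d2fj j x)
    (fun j _ => (hasDerivAt_dfj j x h0 h1).const_mul _)
  exact this

theorem continuous_hh (m p) : Continuous (hh m p) := by
  unfold hh
  exact continuous_finsetSum _ fun j _ => (continuous_fj j).const_mul _

theorem d2hh_le (m p) (hp0 : 1 ≤ p 0) (x : ℝ) (h0 : 0 < x) (h1 : x < 1) : d2hh m p x ≤ -4 := by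
  rw [d2hh, Finset.sum_range_succ']
  have e1 : ∑ k ∈ Finset.range m, (p (k + 1) : ℝ) * d2fj ((k + 1 : ℕ) : ℝ) x ≤ 0 := by
    apply Finset.sum_nonpos
    intro i _
    exact mul_nonpos_of_nonneg_of_nonpos (by positivity) (d2fj_neg _ x h0 h1)
  have e2 := d2fj_zero x h0 h1
  have e3 : (1:ℝ) ≤ p 0 := by exact_mod_cast hp0
  push_cast at e1 ⊢
  nlinarith

/-- global quadratic bound -/
theorem hh_le (m p) (hp0 : 1 ≤ p 0) (l : ℝ) (hl0 : 0 < l) (hl1 : l < 1) (hl : dhh m p l = 0)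
    (x : ℝ) (h0 : 0 ≤ x) (h1 : x ≤ 1) : hh m p x ≤ hh m p l - 2 * (x - l) ^ 2 := by
  set g : ℝ → ℝ := fun y => hh m p y + 2 * (y - l) ^ 2 with hg
  have hgd : ∀ y, 0 < y → y < 1 → HasDerivAt g (dhh m p y + 4 * (y - l)) y := by
    intro y hy0 hy1
    have e := (((hasDerivAt_id y).sub_const l).pow 2).const_mul 2
    refine ((hasDerivAt_hh m p y hy0 hy1).add e).congr_deriv ?_
    simp; ring
  have hgc : Continuous g := by
    have := continuous_hh m p
    fun_prop
  have hd2 : AntitoneOn (fun y => dhh m p y + 4 * (y - l)) (Set.Ioo 0 1) := by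
    have hder : ∀ y ∈ Set.Ioo (0:ℝ) 1, HasDerivAt (fun y => dhh m p y + 4 * (y - l))
        (d2hh m p y + 4 * 1) y := fun y hy =>
      (hasDerivAt_dhh m p y hy.1 hy.2).add (((hasDerivAt_id y).sub_const l).const_mul 4)
    apply antitoneOn_of_deriv_nonpos (convex_Ioo 0 1)
    · exact fun y hy => (hder y hy).continuousAt.continuousWithinAt
    · rw [interior_Ioo]
      exact fun y hy => (hder y hy).differentiableAt.differentiableWithinAt
    · rw [interior_Ioo]
      intro y hy
      rw [(hder y hy).deriv]
      linarith [d2hh_le m p hp0 y hy.1 hy.2]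
  have hz : dhh m p l + 4 * (l - l) = 0 := by rw [hl]; ring
  have key : g x ≤ g l := by
    rcases le_total x l with hxl | hxl
    · have : MonotoneOn g (Set.Icc 0 l) := by
        apply monotoneOn_of_deriv_nonneg (convex_Icc 0 l) hgc.continuousOn
        · rw [interior_Icc]
          exact fun y hy => (hgd y hy.1 (hy.2.trans hl1)).differentiableAt.differentiableWithinAt
        · rw [interior_Icc]
          intro y hy
          rw [(hgd y hy.1 (hy.2.trans hl1)).deriv, ← hz]
          exact hd2 ⟨hy.1, hy.2.trans hl1⟩ ⟨hl0, hl1⟩ hy.2.le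
      exact this ⟨h0, hxl⟩ ⟨hl0.le, le_rfl⟩ hxl
    · have : AntitoneOn g (Set.Icc l 1) := by
        apply antitoneOn_of_deriv_nonpos (convex_Icc l 1) hgc.continuousOn
        · rw [interior_Icc]
          exact fun y hy => (hgd y (hl0.trans hy.1) hy.2).differentiableAt.differentiableWithinAt
        · rw [interior_Icc]
          intro y hy
          rw [(hgd y (hl0.trans hy.1) hy.2).deriv, ← hz]
          exact hd2 ⟨hl0, hl1⟩ ⟨hl0.trans hy.1, hy.2⟩ hy.1.le
      exact this ⟨le_rfl, hl1.le⟩ ⟨hxl, h1⟩ hxl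
  simp only [hg, sub_self] at key
  linarith

/-- Taylor at l, general -/
theorem taylor2 (f f' : ℝ → ℝ) (l D : ℝ) (hf : ∀ᶠ x in 𝓝 l, HasDerivAt f (f' x) x)
    (hf' : HasDerivAt f' D l) (h0 : f' l = 0) :
    (fun x => f x - f l - D / 2 * (x - l) ^ 2) =o[𝓝 l] fun x => (x - l) ^ 2 := by
  rw [Asymptotics.isLittleO_iff]
  intro ε hε
  have h1 := hasDerivAt_iff_isLittleO.1 hf'
  rw [Asymptotics.isLittleO_iff] at h1
  have h2 := (h1 hε).and hf
  obtain ⟨δ, hδ, hball⟩ := Metric.eventually_nhds_iff_ball.1 h2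
  filter_upwards [Metric.ball_mem_nhds l hδ] with x hx
  have hsub : Set.uIcc l x ⊆ Metric.ball l δ := by
    intro y hy
    rw [Metric.mem_ball, Real.dist_eq] at hx ⊢
    exact (Set.abs_sub_left_of_mem_uIcc hy).trans_lt hx
  have := Convex.norm_image_sub_le_of_norm_hasDerivWithin_le (s := Set.uIcc l x)
    (f := fun y => f y - D / 2 * (y - l) ^ 2) (f' := fun y => f' y - D * (y - l)) (C := ε * |x - l|)
    (x := l) (y := x) ?_ ?_ (convex_uIcc l x) Set.left_mem_uIcc Set.right_mem_uIcc
  · simp only [sub_self] at this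
    rw [Real.norm_eq_abs, Real.norm_eq_abs] at this
    rw [Real.norm_eq_abs, Real.norm_eq_abs, abs_pow]
    calc |f x - f l - D / 2 * (x - l) ^ 2| = |f x - D / 2 * (x - l) ^ 2 - (f l - D / 2 * 0 ^ 2)| := by
          congr 1; ring
      _ ≤ _ := this
      _ = _ := by ring
  · intro y hy
    have e := (((hasDerivAt_id y).sub_const l).pow 2).const_mul (D / 2)
    refine (((hball y (hsub hy)).2.sub e).congr_deriv ?_).hasDerivWithinAt
    simp; ring
  · intro y hy
    have := (hball y (hsub hy)).1
    rw [h0] at this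
    simp only [sub_zero, smul_eq_mul, Real.norm_eq_abs] at this ⊢
    rw [mul_comm D]
    refine this.trans (mul_le_mul_of_nonneg_left (Set.abs_sub_left_of_mem_uIcc hy) hε.le)

/-- existence of critical point, with polynomial equation -/
theorem exists_crit (m : ℕ) (p : ℕ → ℕ) (hp0 : 1 ≤ p 0) :
    ∃ l : ℝ, 0 < l ∧ l < 1 ∧ dhh m p l = 0 ∧ IsAlgebraic ℚ l := by
  set pt := ∑ j ∈ Finset.range (m + 1), p j with hpt
  have hpt1 : 1 ≤ pt := hp0.trans (Finset.single_le_sum (f := p) (fun _ _ => Nat.zero_le _) (by simp))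
  set P : ℚ[X] := (1 - X) ^ p 0 * ∏ i ∈ Finset.range m, (1 + ((i + 1 : ℕ) : ℚ[X]) * X) ^ ((i + 1) * p (i + 1)) with hP
  set N : ℚ[X] := X ^ pt * ∏ i ∈ Finset.range m, (1 + ((i : ℕ) : ℚ[X]) * X) ^ (i * p (i + 1)) with hN
  have eP : ∀ x : ℝ, aeval x P = (1 - x) ^ p 0 * ∏ i ∈ Finset.range m, (1 + ((i + 1 : ℕ) : ℝ) * x) ^ ((i + 1) * p (i + 1)) := by
    intro x; simp [hP, map_prod]
  have eN : ∀ x : ℝ, aeval x N = x ^ pt * ∏ i ∈ Finset.range m, (1 + ((i : ℕ) : ℝ) * x) ^ (i * p (i + 1)) := by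
    intro x; simp [hN, map_prod]
  have v0 : aeval (0:ℝ) (P - N) = 1 := by
    rw [map_sub, eP, eN]
    simp [zero_pow (by omega : pt ≠ 0)]
  have v1 : aeval (1:ℝ) (P - N) < 0 := by
    rw [map_sub, eP, eN]
    simp only [sub_self, zero_pow (by omega : p 0 ≠ 0), zero_mul, zero_sub, Left.neg_neg_iff]
    positivity
  have hc : Continuous fun x : ℝ => aeval x (P - N) := (P - N).continuous_aeval
  have hivt := intermediate_value_Icc' (zero_le_one' ℝ) hc.continuousOn
  obtain ⟨l, hl, hl0⟩ := hivt (show (0:ℝ) ∈ Set.Icc _ _ from ⟨v1.le, by rw [v0]; norm_num⟩)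
  have hl0' : aeval l (P - N) = 0 := hl0
  have l0 : 0 < l := lt_of_le_of_ne hl.1 (by rintro rfl; rw [v0] at hl0'; norm_num at hl0')
  have l1 : l < 1 := lt_of_le_of_ne hl.2 (by rintro rfl; linarith)
  refine ⟨l, l0, l1, ?_, P - N, ?_, hl0'⟩
  · have heq : aeval l P = aeval l N := by rw [map_sub] at hl0'; linarith
    rw [eP, eN] at heq
    have hlog := congrArg Real.log heq
    have hA : 0 < 1 - l := by linarith
    have hB : ∀ i : ℕ, 0 < 1 + (i:ℝ) * l := fun i => by positivity
    rw [Real.log_mul (by positivity) (Finset.prod_ne_zero_iff.2 fun i _ => (pow_pos (hB _) _).ne'),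
      Real.log_mul (by positivity) (Finset.prod_ne_zero_iff.2 fun i _ => (pow_pos (hB _) _).ne'),
      Real.log_prod (fun i _ => (pow_pos (hB _) _).ne'), Real.log_prod (fun i _ => (pow_pos (hB _) _).ne'),
      Real.log_pow, Real.log_pow] at hlog
    simp only [Real.log_pow] at hlog
    rw [dhh, Finset.sum_range_succ']
    have hpt' : (pt : ℝ) = ∑ i ∈ Finset.range m, (p (i + 1) : ℝ) + p 0 := by
      rw [hpt, Finset.sum_range_succ']; push_cast; rfl
    rw [hpt', add_mul, Finset.sum_mul] at hlog
    have e1 : ∑ k ∈ Finset.range m, (p (k + 1) : ℝ) * dfj ((k + 1 : ℕ) : ℝ) l =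
        ∑ i ∈ Finset.range m, (((i + 1) * p (i + 1) : ℕ) : ℝ) * Real.log (1 + ((i + 1 : ℕ) : ℝ) * l)
        - ∑ i ∈ Finset.range m, (p (i + 1) : ℝ) * Real.log l
        - ∑ i ∈ Finset.range m, ((i * p (i + 1) : ℕ) : ℝ) * Real.log (1 + (i : ℝ) * l) := by
      rw [← Finset.sum_sub_distrib, ← Finset.sum_sub_distrib]
      apply Finset.sum_congr rfl
      intro i _
      rw [dfj]; push_cast
      rw [add_sub_cancel_right]; ring
    rw [e1]
    have e2 : dfj ((0 : ℕ) : ℝ) l = - Real.log l + Real.log (1 - l) := by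
      rw [dfj]; simp; ring_nf
    rw [e2]
    linarith
  · intro h
    rw [h, map_zero] at v0
    norm_num at v0

end GA
namespace GA
open Polynomial Filter Topology MeasureTheory

theorem floor_integral (n : ℕ) (G : ℤ → ℝ) (hG : ∀ z : ℤ, ¬ (0 ≤ z ∧ z ≤ (n:ℤ)) → G z = 0) :
    ∫ u : ℝ, G ⌊u⌋ = ∑ k ∈ Finset.range (n + 1), G k := by
  have e : ∀ u : ℝ, G ⌊u⌋ = ∑ k ∈ Finset.range (n + 1),
      Set.indicator (Set.Ico (k : ℝ) (k + 1)) (fun _ => G k) u := by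
    intro u
    have hind : ∀ k : ℕ, Set.indicator (Set.Ico (k : ℝ) (k + 1)) (fun _ => G k) u =
        if ⌊u⌋ = (k : ℤ) then G k else 0 := by
      intro k
      rw [Set.indicator_apply]
      congr 1
      rw [Int.floor_eq_iff]; simp
    simp only [hind]
    by_cases h : 0 ≤ ⌊u⌋ ∧ ⌊u⌋ ≤ n
    · obtain ⟨k, hk⟩ := Int.eq_ofNat_of_zero_le h.1
      rw [hk] at h ⊢
      rw [Finset.sum_eq_single k]
      · simp
      · intro i _ hi
        rw [if_neg]; intro hh; exact hi (by exact_mod_cast hh.symm)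
      · intro hk'
        exfalso; apply hk'
        have : k ≤ n := by exact_mod_cast h.2
        simpa [Nat.lt_succ_iff] using this
    · rw [hG _ h, Finset.sum_eq_zero]
      intro k hk
      rw [if_neg]
      intro hh
      apply h
      rw [hh]
      have : k ≤ n := by simpa [Nat.lt_succ_iff] using hk
      exact ⟨by positivity, by exact_mod_cast this⟩
  simp only [e]
  rw [integral_finsetSum]
  · apply Finset.sum_congr rfl
    intro k _
    rw [integral_indicator_const _ measurableSet_Ico]
    simp
  · intro k _
    exact (integrable_indicator_iff measurableSet_Ico).2 (integrableOn_const (by simp) (by simp))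

theorem floor_integral2 (n : ℕ) (G : ℤ → ℝ) (hG : ∀ z : ℤ, ¬ (0 ≤ z ∧ z ≤ (n:ℤ)) → G z = 0)
    (a b : ℝ) (hb : 0 < b) :
    ∫ t : ℝ, G ⌊a + b * t⌋ = (∑ k ∈ Finset.range (n + 1), G k) / b := by
  have h1 := Measure.integral_comp_mul_left (fun u => G ⌊a + u⌋) b
  have h2 := integral_add_left_eq_self (μ := (volume : Measure ℝ)) (fun u => G ⌊u⌋) a
  rw [h1, h2, floor_integral n G hG, abs_of_pos (by positivity), smul_eq_mul]
  ring

noncomputable def GG (m : ℕ) (p : ℕ → ℕ) (l : ℝ) (n : ℕ) (z : ℤ) : ℝ :=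
  if 0 ≤ z ∧ z ≤ n then √n ^ (∑ j ∈ Finset.range (m + 1), p j) * TT m p n z.toNat
    / Real.exp (hh m p l) ^ n else 0

theorem GG_nonneg (m p l n z) : 0 ≤ GG m p l n z := by
  rw [GG]; split_ifs
  · have : 0 ≤ TT m p n z.toNat := Finset.prod_nonneg fun _ _ => by positivity
    positivity
  · exact le_rfl

theorem le_one_add_sq (y : ℝ) : y ≤ 1 + y ^ 2 := by nlinarith [sq_nonneg (y - 1)]

set_option maxHeartbeats 1000000 in
theorem GG_le (m p) (hp0 : 1 ≤ p 0) (l : ℝ) (hl0 : 0 < l) (hl1 : l < 1) (hl : dhh m p l = 0) :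
    ∃ M : ℝ, ∀ n : ℕ, 1 ≤ n → ∀ t : ℝ, GG m p l n ⌊l * n + √n * t⌋ ≤ M * Real.exp (-(1/2) * t ^ 2) := by
  set pt := ∑ j ∈ Finset.range (m + 1), p j with hpt
  set δ := min l (1 - l) / 2 with hδ
  have hδ0 : 0 < δ := by
    have : 0 < min l (1 - l) := lt_min hl0 (by linarith)
    positivity
  have hδ1 : 2 * δ ≤ l := by have := min_le_left l (1 - l); linarith
  have hδ2 : 2 * δ ≤ 1 - l := by have := min_le_right l (1 - l); linarith
  obtain ⟨M, hM0, hM⟩ := TT_le2 m p δ hδ0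
  set M2 : ℝ := (1 / δ) ^ pt * (1 + pt.factorial) with hM2
  have hM20 : 0 ≤ M2 := by positivity
  refine ⟨(M + M2) * Real.exp 1, ?_⟩
  intro n hn t
  rw [GG]
  split_ifs with hz
  swap
  · positivity
  have hn' : (1:ℝ) ≤ n := by exact_mod_cast hn
  have hsn : 1 ≤ √(n:ℝ) := by rwa [Real.one_le_sqrt]
  set z := ⌊l * n + √n * t⌋ with hzdef
  obtain ⟨k, hk⟩ := Int.eq_ofNat_of_zero_le hz.1
  have hkz : (k:ℝ) = z := by rw [hk]; simp
  rw [hk, Int.toNat_natCast]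
  have hkn : k ≤ n := by rw [hk] at hz; exact_mod_cast hz.2
  set x : ℝ := k / n with hx
  have hkx : (k:ℝ) = n * x := by rw [hx]; field_simp
  have hx0 : 0 ≤ x := by positivity
  have hx1 : x ≤ 1 := by rw [hx, div_le_one (by linarith)]; exact_mod_cast hkn
  set s := √n * (x - l) with hs
  have hsq : √(n:ℝ) ^ 2 = n := Real.sq_sqrt (by linarith)
  have hs2 : s ^ 2 = n * (x - l) ^ 2 := by rw [hs, mul_pow, hsq]
  have hst : (s - t) ^ 2 ≤ 1 := by
    have f1 := Int.floor_le (l * n + √n * t)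
    have f2 := Int.lt_floor_add_one (l * n + √n * t)
    rw [← hzdef, ← hkz, hkx] at f1 f2
    have e : √n * (s - t) = n * x - l * n - √n * t := by
      rw [hs]; linear_combination (x - l) * hsq
    have g1 : √n * (s - t) ≤ 0 := by linarith
    have g2 : -1 < √n * (s - t) := by linarith
    have g3 : s - t ≤ 0 := by
      by_contra hh; push Not at hh
      have := mul_pos (by linarith : 0 < √(n:ℝ)) hh
      linarith
    have g4 : -1 ≤ s - t := by nlinarith
    nlinarith
  have hbound : Real.exp (n * hh m p x) ≤ Real.exp (hh m p l) ^ n * Real.exp (-2 * s ^ 2) := by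
    rw [← Real.exp_nat_mul, ← Real.exp_add, Real.exp_le_exp, hs2]
    have := hh_le m p hp0 l hl0 hl1 hl x hx0 hx1
    nlinarith
  have hr : 0 < Real.exp (hh m p l) ^ n := by positivity
  rw [div_le_iff₀ hr]
  have hmain : √n ^ pt * TT m p n k ≤ (M + M2) * Real.exp (- s ^ 2) * Real.exp (hh m p l) ^ n := by
    have e1 : Real.exp (-2 * s ^ 2) = Real.exp (- s ^ 2) * Real.exp (- s ^ 2) := by
      rw [← Real.exp_add]; congr 1; ring
    have e2 : Real.exp (- s ^ 2) ≤ 1 := by rw [Real.exp_le_one_iff]; nlinarith [sq_nonneg s]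
    have e0 : 0 < Real.exp (- s ^ 2) := Real.exp_pos _
    by_cases hxd : |x - l| < δ
    · rw [abs_lt] at hxd
      have := hM n k hn (by linarith) (by linarith)
      calc _ ≤ M * Real.exp (n * hh m p x) := this
        _ ≤ M * (Real.exp (hh m p l) ^ n * Real.exp (-2 * s ^ 2)) := by gcongr
        _ = M * Real.exp (hh m p l) ^ n * Real.exp (- s ^ 2) * Real.exp (- s ^ 2) := by rw [e1]; ring
        _ ≤ M * Real.exp (hh m p l) ^ n * Real.exp (- s ^ 2) * 1 := by gcongr
        _ ≤ _ := by
          have : 0 ≤ M2 * Real.exp (- s ^ 2) * Real.exp (hh m p l) ^ n := by positivity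
          linarith
    · push Not at hxd
      have a1 : √(n:ℝ) ≤ |s| * (1 / δ) := by
        rw [mul_one_div, le_div_iff₀ hδ0, hs, abs_mul, abs_of_nonneg (Real.sqrt_nonneg _)]
        gcongr
      have a2 : |s| ^ pt ≤ (1 + pt.factorial) * Real.exp (s ^ 2) := by
        have b1 : |s| ^ pt ≤ 1 + (s ^ 2) ^ pt := by
          rw [← sq_abs, ← pow_mul, mul_comm 2 pt, pow_mul]
          exact le_one_add_sq _
        have b2 := Real.pow_div_factorial_le_exp (s ^ 2) (sq_nonneg s) pt
        rw [div_le_iff₀ (by positivity)] at b2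
        have b3 : 1 ≤ Real.exp (s ^ 2) := Real.one_le_exp (sq_nonneg s)
        linarith
      have a3 : √(n:ℝ) ^ pt ≤ M2 * Real.exp (s ^ 2) := by
        calc √(n:ℝ) ^ pt ≤ (|s| * (1 / δ)) ^ pt := pow_le_pow_left₀ (Real.sqrt_nonneg _) a1 _
          _ = (1 / δ) ^ pt * |s| ^ pt := by rw [mul_pow]; ring
          _ ≤ (1 / δ) ^ pt * ((1 + pt.factorial) * Real.exp (s ^ 2)) := by gcongr
          _ = _ := by rw [hM2]; ring
      have a4 := TT_le m p n k hn hkn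
      have a5 : 0 ≤ TT m p n k := Finset.prod_nonneg fun _ _ => by positivity
      have e3 : Real.exp (s ^ 2) * Real.exp (- s ^ 2) = 1 := by rw [← Real.exp_add]; simp
      calc _ ≤ M2 * Real.exp (s ^ 2) * (Real.exp (hh m p l) ^ n * Real.exp (-2 * s ^ 2)) :=
            mul_le_mul a3 (a4.trans hbound) a5 (by positivity)
        _ = M2 * Real.exp (hh m p l) ^ n * Real.exp (- s ^ 2) * (Real.exp (s ^ 2) * Real.exp (- s ^ 2)) := by
            rw [e1]; ring
        _ ≤ _ := by
          rw [e3]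
          have : 0 ≤ M * Real.exp (- s ^ 2) * Real.exp (hh m p l) ^ n := by positivity
          linarith
  have hfin : Real.exp (- s ^ 2) ≤ Real.exp 1 * Real.exp (-(1/2) * t ^ 2) := by
    rw [← Real.exp_add, Real.exp_le_exp]
    nlinarith [sq_nonneg (s - (t - s))]
  calc _ ≤ _ := hmain
    _ ≤ (M + M2) * (Real.exp 1 * Real.exp (-(1/2) * t ^ 2)) * Real.exp (hh m p l) ^ n := by gcongr
    _ = _ := by ring

end GA
namespace GA
open Polynomial Filter Topology MeasureTheory

theorem s_lim (l t : ℝ) :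
    Tendsto (fun n : ℕ => √n * ((⌊l * n + √n * t⌋ : ℝ) / n - l)) atTop (𝓝 t) := by
  have hs : Tendsto (fun n : ℕ => √(n:ℝ)) atTop atTop :=
    Real.tendsto_sqrt_atTop.comp tendsto_natCast_atTop_atTop
  have h1 : Tendsto (fun n : ℕ => Int.fract (l * n + √n * t) * (√(n:ℝ))⁻¹) atTop (𝓝 0) := by
    refine squeeze_zero (fun n => by have := Int.fract_nonneg (l * n + √n * t); positivity) (fun n => ?_)
      (tendsto_inv_atTop_zero.comp hs)
    have := (Int.fract_lt_one (l * n + √n * t)).le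
    exact mul_le_of_le_one_left (by positivity) this
  have h2 : Tendsto (fun n : ℕ => t - Int.fract (l * n + √n * t) * (√(n:ℝ))⁻¹) atTop (𝓝 t) := by
    simpa using tendsto_const_nhds.sub h1
  refine h2.congr' ?_
  filter_upwards [eventually_ge_atTop 1] with n hn
  have hn' : (0:ℝ) < n := by exact_mod_cast hn
  have hsn : 0 < √(n:ℝ) := by positivity
  have hsq : √(n:ℝ) ^ 2 = n := Real.sq_sqrt hn'.le
  rw [Int.fract]
  field_simp
  rw [hsq]
  ring_nf

theorem x_lim (l t : ℝ) :
    Tendsto (fun n : ℕ => ((⌊l * n + √n * t⌋ : ℝ) / n)) atTop (𝓝 l) := by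
  have hs : Tendsto (fun n : ℕ => √(n:ℝ)) atTop atTop :=
    Real.tendsto_sqrt_atTop.comp tendsto_natCast_atTop_atTop
  have h := ((tendsto_inv_atTop_zero.comp hs).mul (s_lim l t)).const_add l
  simp only [zero_mul, add_zero] at h
  refine h.congr' ?_
  filter_upwards [eventually_ge_atTop 1] with n hn
  have hn' : (0:ℝ) < n := by exact_mod_cast hn
  have hsn : 0 < √(n:ℝ) := by positivity
  simp only [Function.comp_apply]
  field_simp
  ring

theorem gj_cont (j : ℕ) (l : ℝ) (h0 : 0 < l) (h1 : l < 1) : ContinuousAt (gj j) l := by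
  have hj : (0:ℝ) ≤ j := by positivity
  have p2 : 0 < 1 + ((j:ℝ) - 1) * l := by nlinarith
  unfold gj
  refine ContinuousAt.div (by fun_prop) (by fun_prop) (by positivity)

theorem pt_lim (m p) (l : ℝ) (hl0 : 0 < l) (hl1 : l < 1) (hl : dhh m p l = 0) (t : ℝ) :
    Tendsto (fun n : ℕ => GG m p l n ⌊l * n + √n * t⌋) atTop
      (𝓝 ((∏ j ∈ Finset.range (m + 1), ((√Real.pi / (√Real.pi * √Real.pi)) * √(gj j l / 2)) ^ p j)
        * Real.exp (d2hh m p l / 2 * t ^ 2))) := by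
  set k : ℕ → ℕ := fun n => ⌊l * n + √n * t⌋.toNat with hk
  have hn0 : ∀ᶠ n : ℕ in atTop, 1 ≤ n := eventually_ge_atTop 1
  have hzk : ∀ᶠ n : ℕ in atTop, ⌊l * n + √n * t⌋ = (k n : ℤ) ∧ 1 ≤ k n ∧ k n < n := by
    filter_upwards [hn0, (x_lim l t).eventually (lt_mem_nhds hl0),
      (x_lim l t).eventually (gt_mem_nhds hl1)] with n hn h1 h2
    have hn' : (0:ℝ) < n := by exact_mod_cast hn
    rw [lt_div_iff₀ hn', zero_mul] at h1
    rw [div_lt_one hn'] at h2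
    have h1 : 0 < ⌊l * n + √n * t⌋ := by exact_mod_cast h1
    have h2 : ⌊l * n + √n * t⌋ < (n:ℤ) := by exact_mod_cast h2
    simp only [hk]
    omega
  have hx : Tendsto (fun n => (k n : ℝ) / n) atTop (𝓝 l) := by
    refine (x_lim l t).congr' ?_
    filter_upwards [hzk] with n hn
    rw [hn.1]; simp
  have hs : Tendsto (fun n : ℕ => √n * ((k n : ℝ) / n - l)) atTop (𝓝 t) := by
    refine (s_lim l t).congr' ?_
    filter_upwards [hzk] with n hn
    rw [hn.1]; simp
  have hkinf : Tendsto k atTop atTop := by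
    rw [← tendsto_natCast_atTop_iff (R := ℝ)]
    refine (hx.pos_mul_atTop hl0 tendsto_natCast_atTop_atTop).congr' ?_
    filter_upwards [hn0] with n hn
    have hn' : (0:ℝ) < n := by exact_mod_cast hn
    field_simp
  have hnkinf : Tendsto (fun n => n - k n) atTop atTop := by
    rw [← tendsto_natCast_atTop_iff (R := ℝ)]
    refine ((hx.const_sub 1).pos_mul_atTop (by linarith) tendsto_natCast_atTop_atTop).congr' ?_
    filter_upwards [hn0, hzk] with n hn h
    have hn' : (0:ℝ) < n := by exact_mod_cast hn
    rw [Nat.cast_sub h.2.2.le]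
    field_simp
  have hpi : 0 < √Real.pi := by have := Real.pi_pos; positivity
  have hR : ∀ j, Tendsto (fun n => Rst n (k n) j) atTop (𝓝 (√Real.pi / (√Real.pi * √Real.pi))) := by
    intro j
    unfold Rst
    have S := Stirling.tendsto_stirlingSeq_sqrt_pi
    refine Tendsto.div (S.comp (tendsto_atTop_mono (fun n => Nat.le_add_right n _) tendsto_id))
      ((S.comp hkinf).mul (S.comp (tendsto_atTop_mono (fun n => ?_) hnkinf))) (by positivity)
    exact Nat.sub_le_sub_right (Nat.le_add_right n _) _
  have hE : Tendsto (fun n : ℕ => (n:ℝ) * (hh m p ((k n : ℝ) / n) - hh m p l)) atTop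
      (𝓝 (d2hh m p l / 2 * t ^ 2)) := by
    have ht := taylor2 (hh m p) (dhh m p) l (d2hh m p l)
      (by filter_upwards [lt_mem_nhds hl0, gt_mem_nhds hl1] with x h0 h1
          exact hasDerivAt_hh m p x h0 h1) (hasDerivAt_dhh m p l hl0 hl1) hl
    have ht2 := ht.comp_tendsto hx
    have e : ∀ n : ℕ, (n:ℝ) * ((k n : ℝ) / n - l) ^ 2 = (√n * ((k n : ℝ) / n - l)) ^ 2 := by
      intro n; rw [mul_pow, Real.sq_sqrt (by positivity)]
    have ht3 := (Asymptotics.isBigO_refl (fun n : ℕ => (n:ℝ)) atTop).mul_isLittleO ht2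
    have ht4 : (fun n : ℕ => (n:ℝ) * ((fun x => (x - l) ^ 2) ∘ fun n : ℕ => (k n : ℝ) / n) n)
        =O[atTop] (fun _ => (1:ℝ)) := by
      simp only [Function.comp_apply, e]
      exact (hs.pow 2).isBigO_one ℝ
    have ht5 := (Asymptotics.isLittleO_one_iff ℝ).1 (ht3.trans_isBigO ht4)
    have ht6 := ht5.add ((hs.pow 2).const_mul (d2hh m p l / 2))
    rw [zero_add] at ht6
    refine ht6.congr fun n => ?_
    rw [← e]; simp only [Function.comp_apply]; ring
  have hfin := (tendsto_finsetProd (Finset.range (m + 1)) (fun j _ =>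
    (((hR j).mul ((((gj_cont j l hl0 hl1).tendsto.comp hx).div_const 2).sqrt)).pow (p j)))).mul
    ((Real.continuous_exp.tendsto _).comp hE)
  refine hfin.congr' ?_
  filter_upwards [hzk] with n hn
  rw [GG, if_pos (by omega), hn.1, Int.toNat_natCast, TT_eq m p n (k n) hn.2.1 hn.2.2,
    ← Real.exp_nat_mul, mul_div_assoc, ← Real.exp_sub]
  simp only [Function.comp_apply]
  rw [mul_sub]

end GA
namespace GA
open Polynomial Filter Topology MeasureTheory

theorem asymp0 (m p) (hp0 : 1 ≤ p 0) (l : ℝ) (hl0 : 0 < l) (hl1 : l < 1) (hl : dhh m p l = 0) :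
    Tendsto (fun n : ℕ => (∑ k ∈ Finset.range (n + 1), GG m p l n k) / √n) atTop
      (𝓝 ((∏ j ∈ Finset.range (m + 1), ((√Real.pi / (√Real.pi * √Real.pi)) * √(gj j l / 2)) ^ p j)
        * √(Real.pi / (- d2hh m p l / 2)))) := by
  obtain ⟨M, hM⟩ := GG_le m p hp0 l hl0 hl1 hl
  have hD := d2hh_le m p hp0 l hl0 hl1
  have key := tendsto_integral_filter_of_dominated_convergence (μ := (volume : Measure ℝ))
    (l := atTop) (F := fun (n : ℕ) t => GG m p l n ⌊l * n + √n * t⌋)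
    (f := fun t => ((∏ j ∈ Finset.range (m + 1), ((√Real.pi / (√Real.pi * √Real.pi)) * √(gj j l / 2)) ^ p j)
        * Real.exp (d2hh m p l / 2 * t ^ 2))) (fun t => M * Real.exp (-(1/2) * t ^ 2))
    (Eventually.of_forall fun n => by
      have : Measurable (fun t : ℝ => ⌊l * n + √n * t⌋) := Int.measurable_floor.comp (by fun_prop)
      exact ((measurable_from_top (f := GG m p l n)).comp this).aestronglyMeasurable)
    (by
      filter_upwards [eventually_ge_atTop 1] with n hn
      refine Eventually.of_forall fun t => ?_
      rw [Real.norm_of_nonneg (GG_nonneg _ _ _ _ _)]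
      exact hM n hn t)
    ((integrable_exp_neg_mul_sq (by norm_num)).const_mul M)
    (Eventually.of_forall fun t => pt_lim m p l hl0 hl1 hl t)
  rw [integral_const_mul] at key
  have hg := integral_gaussian (- d2hh m p l / 2)
  have e : ∀ t : ℝ, - (- d2hh m p l / 2) * t ^ 2 = d2hh m p l / 2 * t ^ 2 := fun t => by ring
  simp only [e] at hg
  rw [hg] at key
  refine key.congr' ?_
  filter_upwards [eventually_ge_atTop 1] with n hn
  have hn' : (0:ℝ) < n := by exact_mod_cast hn
  refine floor_integral2 n (GG m p l n) ?_ _ _ (by positivity)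
  intro z hz
  rw [GG, if_neg hz]

theorem alg_sum {ι : Type*} (s : Finset ι) (f : ι → ℝ) (h : ∀ i ∈ s, IsAlgebraic ℚ (f i)) :
    IsAlgebraic ℚ (∑ i ∈ s, f i) := by
  have : ∑ i ∈ s, f i ∈ Subalgebra.algebraicClosure ℚ ℝ := sum_mem fun i hi => h i hi
  exact this

theorem alg_prod {ι : Type*} (s : Finset ι) (f : ι → ℝ) (h : ∀ i ∈ s, IsAlgebraic ℚ (f i)) :
    IsAlgebraic ℚ (∏ i ∈ s, f i) := by
  have : ∏ i ∈ s, f i ∈ Subalgebra.algebraicClosure ℚ ℝ := prod_mem fun i hi => h i hi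
  exact this

theorem alg_sqrt (x : ℝ) (hx : 0 ≤ x) (h : IsAlgebraic ℚ x) : IsAlgebraic ℚ (√x) := by
  refine IsAlgebraic.of_pow (n := 2) (by norm_num) ?_
  rwa [Real.sq_sqrt hx]

theorem alg_lin (l : ℝ) (h : IsAlgebraic ℚ l) (j : ℕ) :
    IsAlgebraic ℚ (1 + (j:ℝ) * l) ∧ IsAlgebraic ℚ (1 + ((j:ℝ) - 1) * l) :=
  ⟨isAlgebraic_one.add ((isAlgebraic_natCast (R := ℚ) (A := ℝ) j).mul h),
    isAlgebraic_one.add (((isAlgebraic_natCast (R := ℚ) (A := ℝ) j).sub isAlgebraic_one).mul h)⟩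

theorem exp_hh_crit (m p) (l : ℝ) (hl0 : 0 < l) (hl1 : l < 1) (hl : dhh m p l = 0) :
    Real.exp (hh m p l) = ∏ j ∈ Finset.range (m + 1), ((1 + (j:ℝ) * l) / (1 + ((j:ℝ) - 1) * l)) ^ p j := by
  have e : hh m p l = ∑ j ∈ Finset.range (m + 1),
      (p j : ℝ) * (Real.log (1 + (j:ℝ) * l) - Real.log (1 + ((j:ℝ) - 1) * l)) := by
    have : hh m p l = hh m p l - l * dhh m p l := by rw [hl]; ring
    rw [this, hh, dhh, Finset.mul_sum, ← Finset.sum_sub_distrib]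
    apply Finset.sum_congr rfl
    intro j _
    rw [fj, dfj, psi, psi, psi]; ring
  rw [e, Real.exp_sum]
  apply Finset.prod_congr rfl
  intro j _
  have hj : (0:ℝ) ≤ j := by positivity
  have p1 : 0 < 1 + (j:ℝ) * l := by positivity
  have p2 : 0 < 1 + ((j:ℝ) - 1) * l := by nlinarith
  rw [Real.exp_nat_mul, Real.exp_sub, Real.exp_log p1, Real.exp_log p2]

theorem asymp (m p) (hp0 : 1 ≤ p 0) : ∃ ρ A : ℝ, 0 < ρ ∧ 0 < A ∧ IsAlgebraic ℚ ρ ∧ IsAlgebraic ℚ A ∧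
    Tendsto (fun n : ℕ => (∑ k ∈ Finset.range (n + 1), TT m p n k) / ρ ^ n
      * √n ^ (∑ j ∈ Finset.range (m + 1), p j - 1)) atTop
      (𝓝 (A / √(2 * Real.pi) ^ (∑ j ∈ Finset.range (m + 1), p j - 1))) := by
  obtain ⟨l, hl0, hl1, hl, hla⟩ := exists_crit m p hp0
  have hD := d2hh_le m p hp0 l hl0 hl1
  have hp1 : ∀ j : ℕ, 0 < 1 + (j:ℝ) * l := fun j => by positivity
  have hp2 : ∀ j : ℕ, 0 < 1 + ((j:ℝ) - 1) * l := fun j => by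
    have : (0:ℝ) ≤ j := by positivity
    nlinarith
  have hg : ∀ j : ℕ, 0 < gj j l := fun j => by
    have := hp1 j; have := hp2 j; rw [gj]; positivity
  have hga : ∀ j : ℕ, IsAlgebraic ℚ (gj j l) := fun j => by
    rw [gj, div_eq_mul_inv]
    exact (alg_lin l hla j).1.mul (hla.mul (alg_lin l hla j).2).inv
  have hDa : IsAlgebraic ℚ (d2hh m p l) := by
    rw [d2hh]
    refine alg_sum _ _ fun j _ => (isAlgebraic_natCast (R := ℚ) (A := ℝ) (p j)).mul ?_
    rw [d2fj, one_div]
    exact ((hla.mul (alg_lin l hla j).1).mul (alg_lin l hla j).2).inv.neg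
  have hPpos : 0 < ∏ j ∈ Finset.range (m + 1), √(gj j l) ^ p j :=
    Finset.prod_pos fun j _ => by have := hg j; positivity
  have hDs : 0 < √(- d2hh m p l) := Real.sqrt_pos.2 (by linarith)
  refine ⟨Real.exp (hh m p l), (∏ j ∈ Finset.range (m + 1), √(gj j l) ^ p j) * (√(- d2hh m p l))⁻¹,
    Real.exp_pos _, by positivity, ?_, ?_, ?_⟩
  · rw [exp_hh_crit m p l hl0 hl1 hl]
    refine alg_prod _ _ fun j _ => IsAlgebraic.pow ?_ _
    rw [div_eq_mul_inv]
    exact (alg_lin l hla j).1.mul (alg_lin l hla j).2.inv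
  · refine IsAlgebraic.mul (alg_prod _ _ fun j _ => (alg_sqrt _ (hg j).le (hga j)).pow _) ?_
    exact (alg_sqrt _ (by linarith) hDa.neg).inv
  have key := asymp0 m p hp0 l hl0 hl1 hl
  set pt := ∑ j ∈ Finset.range (m + 1), p j with hpt
  have hpt1 : 1 ≤ pt := hp0.trans (Finset.single_le_sum (f := p) (fun _ _ => Nat.zero_le _) (by simp))
  obtain ⟨d, hd⟩ : ∃ d, pt = d + 1 := ⟨pt - 1, by omega⟩
  have hpi := Real.pi_pos
  have hsp : 0 < √(2 * Real.pi) := by positivity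
  have hlim : (∏ j ∈ Finset.range (m + 1), ((√Real.pi / (√Real.pi * √Real.pi)) * √(gj j l / 2)) ^ p j)
        * √(Real.pi / (- d2hh m p l / 2)) =
      (∏ j ∈ Finset.range (m + 1), √(gj j l) ^ p j) * (√(- d2hh m p l))⁻¹ / √(2 * Real.pi) ^ (pt - 1) := by
    have e1 : ∀ j : ℕ, (√Real.pi / (√Real.pi * √Real.pi)) * √(gj j l / 2) = √(gj j l) / √(2 * Real.pi) := by
      intro j
      rw [Real.sqrt_div (hg j).le, Real.sqrt_mul (by norm_num)]
      field_simp
    have e2 : √(Real.pi / (- d2hh m p l / 2)) = √(2 * Real.pi) / √(- d2hh m p l) := by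
      rw [← Real.sqrt_div (by positivity)]
      congr 1
      have : - d2hh m p l ≠ 0 := by linarith
      field_simp
    simp only [e1, div_pow, Finset.prod_div_distrib, Finset.prod_pow_eq_pow_sum]
    rw [← hpt, e2, hd, Nat.add_sub_cancel, pow_succ]
    field_simp
  rw [hlim] at key
  refine key.congr' ?_
  filter_upwards [eventually_ge_atTop 1] with n hn
  have hn' : (0:ℝ) < n := by exact_mod_cast hn
  have hsn : 0 < √(n:ℝ) := by positivity
  have e : ∀ k ∈ Finset.range (n + 1), GG m p l n k = √n ^ pt * TT m p n k / Real.exp (hh m p l) ^ n := by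
    intro k hk
    have : k < n + 1 := by simpa using hk
    rw [GG, if_pos (by omega), Int.toNat_natCast]
  rw [Finset.sum_congr rfl e, ← Finset.sum_div, ← Finset.mul_sum, hd, Nat.add_sub_cancel, pow_succ]
  field_simp

end GA

theorem generalized_apery_transcendental_iff
    (m : ℕ) (p : ℕ → ℕ) (hp0 : 1 ≤ p 0) :
    (¬ PowerSeries.IsAlgebraicSeries (PowerSeries.mk fun n =>
      ((∑ k ∈ Finset.range (n + 1),
        ∏ j ∈ Finset.range (m + 1), ((n + j * k).choose k) ^ (p j) : ℕ) : ℚ)))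
      ↔ 2 < ∑ j ∈ Finset.range (m + 1), p j := by
  constructor
  · intro h
    by_contra hle
    push Not at hle
    exact h (GA.alg_case m p hp0 hle)
  · intro h
    rw [GA.algSeries_iff]
    obtain ⟨ρ, A, hρ, hA, hρa, hAa, hT⟩ := GA.asymp m p hp0
    refine GA.transc _ (∑ j ∈ Finset.range (m + 1), p j - 1) (by omega) ρ A hρ hA hρa hAa ?_
    refine hT.congr fun n => ?_
    congr 2
    simp only [GA.TT]
    push_cast
    rfl
end
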